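/- arXiv:math/0601225 — 2 statements merged into one kernel-verified Lean document; each statement's English description precedes it below -/
import Mathlib

section
/- Let x, x_1, …, x_7 be eight points of the complex projective plane such that no four of these points are collinear and no conic passes through seven of them. Then there exists a smooth cubic plane curve passing through these eight points. -/
open MvPolynomial

noncomputable section

/-- The complex projective plane `ℙ²`, as the projectivization of `ℂ³`. -/
abbrev P2 : Type := Projectivization ℂ (Fin 3 → ℂ)

/-- The iterated partial derivative `∂₀^(k 0) ∂₁^(k 1) ∂₂^(k 2) F` of a polynomial in three
variables. -/
def iterDeriv (k : Fin 3 → ℕ) (F : MvPolynomial (Fin 3) ℂ) : MvPolynomial (Fin 3) ℂ :=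
  (fun G => pderiv (0 : Fin 3) G)^[k 0] <|
    (fun G => pderiv (1 : Fin 3) G)^[k 1] <|
      (fun G => pderiv (2 : Fin 3) G)^[k 2] F

/-- `F` vanishes to order at least `m` at the vector `v` : all partial derivatives of total
order `< m` vanish at `v`.  (For `F` homogeneous this is invariant under scaling of `v`, and
for `v ≠ 0` it is the multiplicity condition at the corresponding projective point.) -/
def HasMultGE (F : MvPolynomial (Fin 3) ℂ) (v : Fin 3 → ℂ) (m : ℕ) : Prop :=
  ∀ k : Fin 3 → ℕ, k 0 + k 1 + k 2 < m → eval v (iterDeriv k F) = 0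

/-- `F` vanishes to order at least `m` at the projective point `p`. -/
def pHasMultGE (F : MvPolynomial (Fin 3) ℂ) (p : P2) (m : ℕ) : Prop :=
  HasMultGE F p.rep m

/-- The multiplicity of the plane curve `{F = 0}` at the projective point `p`
(the largest `m` such that all partials of order `< m` vanish at `p`). -/
def pMult (F : MvPolynomial (Fin 3) ℂ) (p : P2) : ℕ :=
  sSup {m : ℕ | pHasMultGE F p m}

/-- The plane curve `{F = 0}` passes through the projective point `p`. -/
def pVanish (F : MvPolynomial (Fin 3) ℂ) (p : P2) : Prop :=
  eval p.rep F = 0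

/-- The plane curve `{F = 0}` is smooth (every point of it is a nonsingular point). -/
def SmoothPlaneCurve (F : MvPolynomial (Fin 3) ℂ) : Prop :=
  ∀ p : P2, pVanish F p → ∃ i : Fin 3, eval p.rep (pderiv i F) ≠ 0

/-- `p` is a singular point of the plane curve `{F = 0}`. -/
def SingularAt (F : MvPolynomial (Fin 3) ℂ) (p : P2) : Prop :=
  pVanish F p ∧ ∀ i : Fin 3, eval p.rep (pderiv i F) = 0

/-- A tuple of points of `ℙ²` is in general position if the points are pairwise distinct,
no `3` of them lie on a line, no `6` of them lie on a conic, and no `8` of them lie on a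
cubic which is singular at one of them. -/
def GenPos {n : ℕ} (p : Fin n → P2) : Prop :=
  Function.Injective p ∧
  (∀ f : Fin 3 ↪ Fin n, ¬ ∃ L : MvPolynomial (Fin 3) ℂ,
      L ≠ 0 ∧ L.IsHomogeneous 1 ∧ ∀ k, pVanish L (p (f k))) ∧
  (∀ f : Fin 6 ↪ Fin n, ¬ ∃ Q : MvPolynomial (Fin 3) ℂ,
      Q ≠ 0 ∧ Q.IsHomogeneous 2 ∧ ∀ k, pVanish Q (p (f k))) ∧
  (∀ f : Fin 8 ↪ Fin n, ¬ ∃ F : MvPolynomial (Fin 3) ℂ,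
      F ≠ 0 ∧ F.IsHomogeneous 3 ∧ (∀ k, pVanish F (p (f k))) ∧ ∃ k, pHasMultGE F (p (f k)) 2)

/-- The irreducible plane curve `{F = 0}` is rational: it admits a nonconstant parametrization
by `ℙ¹`, given by a triple of homogeneous polynomials of the same degree in two variables. -/
def RatPlaneCurve (F : MvPolynomial (Fin 3) ℂ) : Prop :=
  ∃ (φ : Fin 3 → MvPolynomial (Fin 2) ℂ) (e : ℕ),
    (∀ j, (φ j).IsHomogeneous e) ∧
    (∃ s t : Fin 2 → ℂ, ∀ c : ℂ,
      (fun j => eval s (φ j)) ≠ c • fun j => eval t (φ j)) ∧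
    aeval φ F = 0

/-- Data of the blow-up `X` of `ℙ²` at the `r` distinct points `pts`, together with its theory
of (irreducible, reduced) curves:  `mem x C` says that `x` lies on the curve `C`, `mult x C`
is the multiplicity of `C` at `x`, the class of a curve `C` in `Pic X = ℤH ⊕ ⨁ᵢ ℤEᵢ` is
`degH C · H - ∑ i, multE C i · Eᵢ`, `interK C` is the intersection number `(-K_X)·C`
(so `interK C = 3 degH C - ∑ i multE C i`), `rational C` (resp. `nodal C`) says that `C` is a
rational (resp. nodal) curve, and `Eexc i` is the exceptional curve over `pts i`.
Away from the blown-up points, the blow-up map `μ` is a bijection, and the non-exceptional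
curves are exactly the strict transforms of the irreducible plane curves, with the
corresponding classes and multiplicities. -/
structure BlowupP2 (r : ℕ) (pts : Fin r → P2) where
  X : Type
  μ : X → P2
  μ_surj : Function.Surjective μ
  μ_unique : ∀ q : P2, q ∉ Set.range pts → ∃! x : X, μ x = q
  Curve : Type
  mem : X → Curve → Prop
  mult : X → Curve → ℕ
  mult_pos_iff : ∀ (x : X) (C : Curve), 0 < mult x C ↔ mem x C
  degH : Curve → ℕ
  multE : Curve → Fin r → ℤ
  interK : Curve → ℤ
  interK_eq : ∀ C : Curve, interK C = 3 * (degH C : ℤ) - ∑ i, multE C i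
  rational : Curve → Prop
  nodal : Curve → Prop
  nodal_mult : ∀ C : Curve, nodal C → ∀ x : X, mult x C ≤ 2
  Eexc : Fin r → Curve
  mem_exc : ∀ (i : Fin r) (x : X), mem x (Eexc i) ↔ μ x = pts i
  exc_degH : ∀ i, degH (Eexc i) = 0
  exc_multE_self : ∀ i, multE (Eexc i) i = -1
  exc_multE_ne : ∀ i j, i ≠ j → multE (Eexc i) j = 0
  exc_rational : ∀ i, rational (Eexc i)
  strict_exists : ∀ (d : ℕ) (F : MvPolynomial (Fin 3) ℂ),
    F.IsHomogeneous d → Irreducible F →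
    ∃ C : Curve, degH C = d ∧ (∀ i, multE C i = (pMult F (pts i) : ℤ)) ∧
      (∀ x : X, μ x ∉ Set.range pts →
        ((mem x C ↔ pVanish F (μ x)) ∧ mult x C = pMult F (μ x))) ∧
      (rational C ↔ RatPlaneCurve F)
  curve_cases : ∀ C : Curve, (∃ i, C = Eexc i) ∨
    ∃ (d : ℕ) (F : MvPolynomial (Fin 3) ℂ),
      F.IsHomogeneous d ∧ Irreducible F ∧
      degH C = d ∧ (∀ i, multE C i = (pMult F (pts i) : ℤ)) ∧
      (∀ x : X, μ x ∉ Set.range pts →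
        ((mem x C ↔ pVanish F (μ x)) ∧ mult x C = pMult F (μ x))) ∧
      (rational C ↔ RatPlaneCurve F)

namespace BlowupP2

variable {r : ℕ} {pts : Fin r → P2}

/-- The Seshadri constant of the anticanonical divisor `-K_X` at a point `x` of the blow-up:
the infimum over all irreducible curves `C` through `x` of `((-K_X)·C) / mult_x C`. -/
def seshadri (B : BlowupP2 r pts) (x : B.X) : ℝ :=
  sInf {t : ℝ | ∃ C : B.Curve, B.mem x C ∧ t = (B.interK C : ℝ) / (B.mult x C : ℝ)}

/-- A point `x` of the blow-up of `ℙ²` at `pts` is in general position if its image `μ x` is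
distinct from the blown-up points and the points `pts` together with `μ x` are in general
position. -/
def genPosPt (B : BlowupP2 r pts) (x : B.X) : Prop :=
  B.μ x ∉ Set.range pts ∧ GenPos (Fin.snoc pts (B.μ x))

end BlowupP2

/-- The zero locus in `(ℙ²)^r` of a polynomial in the coordinates of the `r` points. -/
def projZeroSet {r : ℕ} (f : MvPolynomial (Fin r × Fin 3) ℂ) : Set (Fin r → P2) :=
  {p | eval (fun q => (p q.1).rep q.2) f = 0}

/-- The vanishing of `f` at a tuple of nonzero vectors only depends on the corresponding tuple
of projective points (so that `projZeroSet f` is a well-defined closed subvariety of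
`(ℙ²)^r`). -/
def GoodFamilyPoly (r : ℕ) (f : MvPolynomial (Fin r × Fin 3) ℂ) : Prop :=
  ∀ v w : Fin r → Fin 3 → ℂ,
    (∀ i, ∃ c : ℂ, c ≠ 0 ∧ w i = c • v i) →
    (eval (fun q => v q.1 q.2) f = 0 → eval (fun q => w q.1 q.2) f = 0)

/-- `P` holds for every tuple of `r` points of `ℙ²` in very general position: there is a
countable family of proper closed hypersurfaces of `(ℙ²)^r` such that `P p` holds for every
tuple `p` avoiding all of them. -/
def VeryGeneralHolds (r : ℕ) (P : (Fin r → P2) → Prop) : Prop :=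
  ∃ bad : ℕ → MvPolynomial (Fin r × Fin 3) ℂ,
    (∀ n, GoodFamilyPoly r (bad n)) ∧
    (∀ n, projZeroSet (bad n) ≠ Set.univ) ∧
    ∀ p : Fin r → P2, (∀ n, p ∉ projZeroSet (bad n)) → P p

section Helpers

lemma formallySmooth_charZero (K L : Type) [Field K] [Field L] [CharZero K] [Algebra K L] :
    Algebra.FormallySmooth K L := by
  obtain ⟨s, hs⟩ := exists_isTranscendenceBasis K L
  have := hs.isAlgebraic_field
  have : CharZero (IntermediateField.adjoin K (Set.range ((↑) : s → L))) := 
    charZero_of_injective_algebraMap (algebraMap K _).injective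
  exact .of_algebraicIndependent_of_isSeparable hs.1

lemma exists_der (k : Subfield ℂ) (t : ℂ) (ht : Transcendental k t) :
    ∃ D : Derivation k ℂ ℂ, D t = 1 := by
  let K := FractionRing (Polynomial k)
  have hinj : Function.Injective (Polynomial.aeval (R := k) t) := transcendental_iff_injective.1 ht
  let f1 : K →+* ℂ := IsFractionRing.lift (A := Polynomial k) (g := (Polynomial.aeval (R := k) t).toRingHom) hinj
  let g2 : Polynomial k →+* DualNumber ℂ := (Polynomial.aeval (R := k) (TrivSqZeroExt.inl t + DualNumber.eps : DualNumber ℂ)).toRingHom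
  have hg : ∀ p, (g2 p).fst = Polynomial.aeval t p := by
    intro p
    have := Polynomial.aeval_algHom_apply (TrivSqZeroExt.fstHom k ℂ ℂ) (TrivSqZeroExt.inl t + DualNumber.eps : DualNumber ℂ) p
    simpa [g2] using this.symm
  let f2 : K →+* DualNumber ℂ := IsLocalization.lift (M := nonZeroDivisors (Polynomial k)) (g := g2) (by
    intro y
    rw [TrivSqZeroExt.isUnit_iff_isUnit_fst, hg, isUnit_iff_ne_zero]
    intro h
    have : (y : Polynomial k) = 0 := hinj (by simpa using h)
    exact nonZeroDivisors.coe_ne_zero y this)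
  have hf : ∀ x, (f2 x).fst = f1 x := by
    intro x
    have : (TrivSqZeroExt.fstHom ℂ ℂ ℂ).toRingHom.comp f2 = f1 := by
      apply IsLocalization.ringHom_ext (nonZeroDivisors (Polynomial k))
      apply RingHom.ext
      intro p
      simp [f1, f2, hg]
    exact congr($this x)
  let a1 : Algebra K ℂ := f1.toAlgebra
  let a2 : Algebra K (DualNumber ℂ) := f2.toAlgebra
  have := formallySmooth_charZero K ℂ
  let q : DualNumber ℂ →ₐ[K] ℂ := { (TrivSqZeroExt.fstHom ℂ ℂ ℂ).toRingHom with commutes' := fun x => hf x }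
  have hq : Function.Surjective q := fun x => ⟨TrivSqZeroExt.inl x, by simp [q]⟩
  have hq' : IsNilpotent (RingHom.ker q) := by
    refine ⟨2, ?_⟩
    refine (pow_two (RingHom.ker q)).trans ?_
    refine eq_bot_iff.2 (Ideal.mul_le.2 ?_)
    intro a ha b hb
    have ha : a.fst = 0 := ha
    have hb : b.fst = 0 := hb
    show _ = _
    ext <;> simp [ha, hb]
  let φ := Algebra.FormallySmooth.liftOfSurjective (AlgHom.id K ℂ) q hq hq'
  have h1 : ∀ x, (φ x).fst = x := fun x => 
    Algebra.FormallySmooth.liftOfSurjective_apply (AlgHom.id K ℂ) q hq hq' x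
  have hk : ∀ c : k, φ c = TrivSqZeroExt.inl (c : ℂ) := by
    intro c
    have := φ.commutes (algebraMap (Polynomial k) K (Polynomial.C c))
    have e1 : algebraMap K ℂ (algebraMap (Polynomial k) K (Polynomial.C c)) = c := by
      show f1 _ = _
      simp [f1]; rfl
    have e2 : algebraMap K (DualNumber ℂ) (algebraMap (Polynomial k) K (Polynomial.C c)) = TrivSqZeroExt.inl (c : ℂ) := by
      show f2 _ = _
      simp [f2, g2]; rfl
    rw [e1, e2] at this
    exact this
  have hT : φ t = TrivSqZeroExt.inl t + DualNumber.eps := by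
    have := φ.commutes (algebraMap (Polynomial k) K Polynomial.X)
    have e1 : algebraMap K ℂ (algebraMap (Polynomial k) K Polynomial.X) = t := by
      show f1 _ = _
      simp [f1]
    have e2 : algebraMap K (DualNumber ℂ) (algebraMap (Polynomial k) K Polynomial.X) = TrivSqZeroExt.inl t + DualNumber.eps := by
      show f2 _ = _
      simp [f2, g2]
    rw [e1, e2] at this
    exact this
  refine ⟨Derivation.mk' (R := k) { toFun := fun x => (φ x).snd, map_add' := by simp, map_smul' := ?_ } ?_, ?_⟩
  · intro c x
    have : c • x = (c : ℂ) * x := rfl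
    rw [this, map_mul, hk]
    simp; rfl
  · intro a b
    simp [h1, mul_comm]
  · simp [hT]

lemma der_eval (k : Subfield ℂ) (D : Derivation k ℂ ℂ) (v : Fin 3 → ℂ) (F : MvPolynomial (Fin 3) ℂ)
    (hF : ∀ m, F.coeff m ∈ k) :
    D (eval v F) = ∑ i, eval v (pderiv i F) * D (v i) := by
  obtain ⟨F0, rfl⟩ : F ∈ Set.range (MvPolynomial.map (σ := Fin 3) k.subtype) := by
    apply MvPolynomial.mem_range_map_iff_coeffs_subset.2
    intro c hc
    obtain ⟨m, _, rfl⟩ := MvPolynomial.mem_coeffs_iff.1 (Finset.mem_coe.1 hc)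
    exact ⟨⟨_, hF m⟩, rfl⟩
  clear hF
  induction F0 using MvPolynomial.induction_on with
  | C a =>
    have := D.map_algebraMap a
    simp only [map_C, eval_C, pderiv_C, map_zero, zero_mul, Finset.sum_const_zero]
    exact this
  | add p q hp hq => simp only [map_add, hp, hq, add_mul, Finset.sum_add_distrib]
  | mul_X p n hp =>
    simp only [map_mul, Derivation.leibniz, hp, map_X, eval_X, pderiv_X, smul_eq_mul, map_add, add_mul, Finset.sum_add_distrib, Finset.mul_sum]
    congr 1
    · rw [Finset.sum_eq_single n]
      · simp
      · intro b _ hb; simp [hb.symm]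
      · simp
    · apply Finset.sum_congr rfl; intros; ring

lemma exists_good (S : Finset (MvPolynomial (Fin 3) ℂ)) :
    ∃ T : Set ℂ, T.Infinite ∧ ∀ t ∈ T, ∃ D : ℂ → ℂ, D 0 = 0 ∧ (∀ a b, D (a + b) = D a + D b) ∧
      (∀ a b, D (a * b) = a * D b + b * D a) ∧ D t = 1 ∧ ∀ F ∈ S, ∀ v, D (eval v F) = ∑ i, eval v (pderiv i F) * D (v i) := by
  let s : Set ℂ := ⋃ F ∈ S, (F.coeffs : Set ℂ)
  have hs : s.Finite := S.finite_toSet.biUnion (fun F _ => F.coeffs.finite_toSet)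
  let k := Subfield.closure s
  have hk : Countable k := by
    rw [← Cardinal.mk_le_aleph0_iff]
    refine (Subfield.cardinalMk_closure_le_max s).trans ?_
    simp [hs.countable]
  have hc := Algebraic.countable k ℂ
  refine ⟨{x | IsAlgebraic k x}ᶜ, ?_, ?_⟩
  · intro hfin
    have := hfin.countable.union hc
    rw [Set.compl_union_self] at this
    exact not_countable_complex this
  · intro t ht
    obtain ⟨D, hD⟩ := exists_der k t ht
    refine ⟨D, map_zero D, map_add D, fun a b => by simp, hD, fun F hF v => der_eval k D v F ?_⟩
    intro m
    by_cases h : F.coeff m = 0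
    · rw [h]; exact k.zero_mem
    · apply Subfield.subset_closure
      simp only [s, Set.mem_iUnion]
      exact ⟨F, hF, by simpa using coeff_mem_coeffs m h⟩

lemma coprime_frac {R : Type} [CommRing R] [IsDomain R] [UniqueFactorizationMonoid R]
    (f g : Polynomial R) (hf : f ≠ 0) (h : IsRelPrime f g) :
    IsCoprime (f.map (algebraMap R (FractionRing R))) (g.map (algebraMap R (FractionRing R))) := by
  classical
  let _ : StrongNormalizationMonoid R := UniqueFactorizationMonoid.strongNormalizationMonoid
  let _ := UniqueFactorizationMonoid.toNormalizedGCDMonoid R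
  set K := FractionRing R
  have hinj := IsFractionRing.injective R K
  rw [← isRelPrime_iff_isCoprime]
  intro d hd1 hd2
  have hd0 : d ≠ 0 := by
    rintro rfl
    rw [zero_dvd_iff, Polynomial.map_eq_zero_iff hinj] at hd1
    exact hf hd1
  let e := (IsLocalization.integerNormalization (nonZeroDivisors R) d)
  obtain ⟨b, hbM, hb⟩ := IsLocalization.integerNormalization_spec (nonZeroDivisors R) d
  have hb0 : algebraMap R K b ≠ 0 := by
    rw [Ne, map_eq_zero_iff _ hinj]
    exact nonZeroDivisors.ne_zero hbM
  have hde : d ∣ e.map (algebraMap R K) ∧ e.map (algebraMap R K) ∣ d := by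
    have hb' : e.map (algebraMap R K) = Polynomial.C (algebraMap R K b) * d := by
      rw [hb, Algebra.smul_def]; rfl
    rw [hb']
    refine ⟨Dvd.intro_left _ rfl, Polynomial.C (algebraMap R K b)⁻¹, ?_⟩
    rw [mul_right_comm, ← Polynomial.C_mul, mul_inv_cancel₀ hb0, Polynomial.C_1, one_mul]
  have he0 : e ≠ 0 := by
    intro he
    rw [he] at hde
    simp at hde
    exact hd0 hde
  have hp : e.primPart.map (algebraMap R K) ∣ e.map (algebraMap R K) :=
    Polynomial.map_dvd _ e.primPart_dvd
  have h1 : e.primPart ∣ f := (e.isPrimitive_primPart.dvd_iff_fraction_map_dvd_fraction_map K).2 (hp.trans (hde.2.trans hd1))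
  have h2 : e.primPart ∣ g := (e.isPrimitive_primPart.dvd_iff_fraction_map_dvd_fraction_map K).2 (hp.trans (hde.2.trans hd2))
  have h3 := h h1 h2
  have h4 : e.natDegree = 0 := by
    rw [← Polynomial.natDegree_primPart]; exact Polynomial.natDegree_eq_zero_of_isUnit h3
  have h5 : (e.map (algebraMap R K)).natDegree = 0 := by
    rw [Polynomial.natDegree_map_eq_of_injective hinj, h4]
  have h6 : d.natDegree = 0 := by
    have := Polynomial.natDegree_le_of_dvd hde.1 (by rwa [Ne, Polynomial.map_eq_zero_iff hinj])
    omega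
  rw [Polynomial.eq_C_of_natDegree_eq_zero h6] at hd0 ⊢
  exact Polynomial.isUnit_C.2 (isUnit_iff_ne_zero.2 (by simpa using hd0))

lemma elim_poly {R : Type} [CommRing R] [IsDomain R] [UniqueFactorizationMonoid R]
    (f g : Polynomial R) (hf : f ≠ 0) (h : IsRelPrime f g) :
    ∃ r : R, r ≠ 0 ∧ ∃ a b, a * f + b * g = Polynomial.C r := by
  by_cases hd : f.natDegree = 0
  · rw [Polynomial.eq_C_of_natDegree_eq_zero hd] at hf ⊢
    exact ⟨_, by simpa using hf, 1, 0, by simp⟩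
  obtain ⟨p, q, -, -, hpq⟩ := Polynomial.exists_mul_add_mul_eq_C_resultant f g le_rfl le_rfl (Or.inl hd)
  refine ⟨_, ?_, p, q, by rw [← hpq]; ring⟩
  intro h0
  have hinj := IsFractionRing.injective R (FractionRing R)
  have := Polynomial.resultant_map_map f g f.natDegree g.natDegree (algebraMap R (FractionRing R))
  rw [h0, map_zero] at this
  have h2 := (Polynomial.resultant_eq_zero_iff (f := f.map (algebraMap R (FractionRing R))) (g := g.map (algebraMap R (FractionRing R)))).1 (by
    rwa [Polynomial.natDegree_map_eq_of_injective hinj, Polynomial.natDegree_map_eq_of_injective hinj])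
  exact h2.2 (coprime_frac f g hf h)

lemma elim0 (F G : MvPolynomial (Fin 3) ℂ) (hF : F ≠ 0) (h : IsRelPrime F G) :
    ∃ r : MvPolynomial (Fin 3) ℂ, r ≠ 0 ∧ (∃ a b, a * F + b * G = r) ∧
      ∀ x c, eval (Function.update x 0 c) r = eval x r := by
  let e := finSuccEquiv ℂ 2
  obtain ⟨r, hr, a, b, hab⟩ := elim_poly (e F) (e G) (by simpa using hF) (by
    intro d h1 h2
    have h1 := map_dvd e.symm h1
    have h2 := map_dvd e.symm h2
    simp only [AlgEquiv.symm_apply_apply] at h1 h2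
    have := (h h1 h2).map e
    simpa using this)
  refine ⟨e.symm (Polynomial.C r), by simpa using hr, ⟨e.symm a, e.symm b, ?_⟩, ?_⟩
  · rw [← hab]; simp
  · intro x c
    have : e.symm (Polynomial.C r) = rename Fin.succ r := by
      rw [AlgEquiv.symm_apply_eq]
      clear hab hr
      induction r using MvPolynomial.induction_on with
      | C a => simp [e, finSuccEquiv_apply]
      | add p q hp hq => simp [hp, hq]
      | mul_X p n hp => simp [← hp, e, finSuccEquiv_X_succ]
    rw [this, eval_rename, eval_rename]
    congr 1

lemma elimi (i : Fin 3) (F G : MvPolynomial (Fin 3) ℂ) (hF : F ≠ 0) (h : IsRelPrime F G) :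
    ∃ r : MvPolynomial (Fin 3) ℂ, r ≠ 0 ∧ (∃ a b, a * F + b * G = r) ∧
      ∀ x c, eval (Function.update x i c) r = eval x r := by
  let s := Equiv.swap 0 i
  let e := renameEquiv ℂ s
  obtain ⟨r, hr, ⟨a, b, hab⟩, hx⟩ := elim0 (e F) (e G) (by simpa using hF) (by
    intro d h1 h2
    have h1 := map_dvd e.symm h1
    have h2 := map_dvd e.symm h2
    simp only [AlgEquiv.symm_apply_apply] at h1 h2
    have := (h h1 h2).map e
    simpa using this)
  refine ⟨e.symm r, by simpa using hr, ⟨e.symm a, e.symm b, ?_⟩, ?_⟩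
  · rw [← hab]; simp
  · intro x c
    have he : e.symm r = rename s r := by simp [e, s]
    rw [he, eval_rename, eval_rename, ← hx (x ∘ s) c]
    congr 2
    funext k
    simp only [Function.comp, Function.update_apply, s]
    congr 1
    rw [Equiv.swap_apply_eq_iff]; simp

lemma ratio_finite (F G : MvPolynomial (Fin 3) ℂ) (hF : F ≠ 0) (h : IsRelPrime F G)
    (j k : Fin 3) :
    {s : ℂ | ∃ x : Fin 3 → ℂ, x j ≠ 0 ∧ (∀ c : ℂ, eval (c • x) F = 0) ∧ (∀ c : ℂ, eval (c • x) G = 0) ∧ s = x k / x j}.Finite := by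
  by_cases hjk : j = k
  · subst hjk
    apply (Set.finite_singleton (1 : ℂ)).subset
    rintro s ⟨x, hx, -, -, rfl⟩
    simp [hx]
  obtain ⟨i, hij, hik⟩ : ∃ i : Fin 3, i ≠ j ∧ i ≠ k := by
    revert j k; decide
  obtain ⟨r, hr, ⟨a, b, hab⟩, hinv⟩ := elimi i F G hF h
  obtain ⟨y, hy⟩ : ∃ y, eval y (r * X j) ≠ 0 := by
    by_contra! hc
    exact mul_ne_zero hr (X_ne_zero j) (MvPolynomial.funext (by simpa using hc))
  simp only [eval_mul, eval_X, mul_ne_zero_iff] at hy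
  let u : Fin 3 → Polynomial ℂ := fun m => if m = j then Polynomial.C (y j) else if m = k then Polynomial.C (y j) * Polynomial.X else 0
  let q : Polynomial ℂ := aeval u r
  have hq : ∀ s, q.eval s = eval (fun m => (u m).eval s) r := by
    intro s
    have := MvPolynomial.map_aeval u (Polynomial.evalRingHom s) r
    simp only [Polynomial.coe_evalRingHom] at this
    rw [this, MvPolynomial.eval]
    congr 2
    ext a; simp
  have hq0 : q ≠ 0 := by
    intro h0
    have := hq (y k / y j)
    rw [h0, Polynomial.eval_zero, ← hinv _ (y i)] at this
    apply hy.1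
    rw [this]
    congr 2
    funext m
    have : m = i ∨ m = j ∨ m = k := by clear * - hij hik hjk; revert m i j k; decide
    rcases this with rfl | rfl | rfl
    · simp
    · simp [u, hij.symm]
    · simp [u, hik.symm, Ne.symm hjk]
      field_simp [hy.2]
  apply (q.rootSet_finite ℂ).subset
  rintro s ⟨x, hx, hxF, hxG, rfl⟩
  rw [Polynomial.mem_rootSet]
  refine ⟨hq0, ?_⟩
  rw [Polynomial.coe_aeval_eq_eval, hq, ← hinv _ ((y j / x j) * x i)]
  have : Function.update (fun m => (u m).eval (x k / x j)) i ((y j / x j) * x i) = (y j / x j) • x := by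
    funext m
    have : m = i ∨ m = j ∨ m = k := by clear * - hij hik hjk; revert m i j k; decide
    rcases this with rfl | rfl | rfl
    · simp
    · simp [u, hij.symm]
      field_simp
    · simp [u, hik.symm, Ne.symm hjk]
      field_simp
  rw [this, ← hab]
  simp [hxF, hxG]

lemma base_finite (F G : MvPolynomial (Fin 3) ℂ) (hF : F ≠ 0) (h : IsRelPrime F G) :
    {z : Fin 3 × (Fin 3 → ℂ) | ∃ x : Fin 3 → ℂ, x z.1 ≠ 0 ∧ (∀ c : ℂ, eval (c • x) F = 0) ∧
      (∀ c : ℂ, eval (c • x) G = 0) ∧ ∀ k, z.2 k = x k / x z.1}.Finite := by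
  have : (⋃ j : Fin 3, ((fun y => (j, y)) '' (Set.univ.pi fun k => 
     {s : ℂ | ∃ x : Fin 3 → ℂ, x j ≠ 0 ∧ (∀ c : ℂ, eval (c • x) F = 0) ∧ (∀ c : ℂ, eval (c • x) G = 0) ∧ s = x k / x j}))).Finite := by
    refine Set.finite_iUnion fun j => Set.Finite.image _ (Set.Finite.pi fun k => ratio_finite F G hF h j k)
  refine this.subset ?_
  rintro ⟨j, y⟩ ⟨x, h1, h2, h3, h4⟩
  simp only [Set.mem_iUnion]
  exact ⟨j, y, fun k _ => ⟨x, h1, h2, h3, h4 k⟩, rfl⟩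

def homPhi : MvPolynomial (Fin 3) ℂ →ₐ[ℂ] Polynomial (MvPolynomial (Fin 3) ℂ) :=
  aeval (fun i => Polynomial.C (X i) * Polynomial.X)

lemma homPhi_monomial (m : Fin 3 →₀ ℕ) (a : ℂ) :
    homPhi (monomial m a) = Polynomial.monomial m.degree (monomial m a) := by
  rw [homPhi, aeval_monomial, Finsupp.prod_fintype _ _ (by simp), Finsupp.degree_eq_sum]
  rw [← Polynomial.C_mul_X_pow_eq_monomial]
  simp only [mul_pow, Finset.prod_mul_distrib, ← Finset.prod_pow_eq_pow_sum]
  rw [← mul_assoc]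
  congr 1
  rw [monomial_eq, Finsupp.prod_fintype _ _ (by simp)]
  simp only [map_mul, map_prod, map_pow]
  rfl

lemma homPhi_coeff (P : MvPolynomial (Fin 3) ℂ) (k : ℕ) (m : Fin 3 →₀ ℕ) :
    coeff m ((homPhi P).coeff k) = if m.degree = k then coeff m P else 0 := by
  induction P using MvPolynomial.induction_on' with
  | monomial u a =>
    rw [homPhi_monomial, Polynomial.coeff_monomial]
    by_cases h : u = m
    · subst h; split_ifs <;> simp
    · split_ifs <;> simp [coeff_monomial, h]
  | add p q hp hq => simp only [map_add, Polynomial.coeff_add, coeff_add, hp, hq]; split_ifs <;> simp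

lemma homPhi_hom {P : MvPolynomial (Fin 3) ℂ} {n : ℕ} (h : P.IsHomogeneous n) :
    homPhi P = Polynomial.monomial n P := by
  ext k m
  rw [homPhi_coeff, Polynomial.coeff_monomial]
  by_cases hc : coeff m P = 0
  · split_ifs <;> simp [hc]
  · have : m.degree = n := by
      have : Finsupp.weight (fun _ => 1) m = n := h hc
      rwa [← Finsupp.degree_eq_weight_one] at this
    subst this
    split_ifs <;> simp

lemma hom_factor {H A : MvPolynomial (Fin 3) ℂ} {n : ℕ} (h : (H * A).IsHomogeneous n) (h0 : H * A ≠ 0) :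
    ∃ m k, m + k = n ∧ H.IsHomogeneous m ∧ A.IsHomogeneous k := by
  have e := homPhi_hom h
  rw [map_mul] at e
  have hne : homPhi H * homPhi A ≠ 0 := by rw [e]; simpa using h0
  have hH := left_ne_zero_of_mul hne
  have hA := right_ne_zero_of_mul hne
  have d1 := Polynomial.natDegree_mul hH hA
  have d2 := Polynomial.natTrailingDegree_mul hH hA
  rw [e, Polynomial.natDegree_monomial_eq _ h0] at d1
  rw [e, Polynomial.natTrailingDegree_monomial h0] at d2
  have l1 := Polynomial.natTrailingDegree_le_natDegree (homPhi H)
  have l2 := Polynomial.natTrailingDegree_le_natDegree (homPhi A)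
  have key : ∀ P : MvPolynomial (Fin 3) ℂ, (homPhi P).natTrailingDegree = (homPhi P).natDegree →
      P.IsHomogeneous (homPhi P).natDegree := by
    intro P hP m hm
    show Finsupp.weight (fun _ => 1) m = _
    rw [← Finsupp.degree_eq_weight_one]
    have := homPhi_coeff P m.degree m
    rw [if_pos rfl] at this
    have h1 : (homPhi P).coeff m.degree ≠ 0 := by
      intro h; rw [h] at this; exact hm (by simpa using this.symm)
    have h2 := Polynomial.le_natDegree_of_ne_zero h1
    have h3 := Polynomial.natTrailingDegree_le_of_ne_zero h1
    show m.degree = _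
    omega
  exact ⟨_, _, d1.symm, key H (by omega), key A (by omega)⟩

/-- linear form -/
def lin (a : Fin 3 → ℂ) : MvPolynomial (Fin 3) ℂ := ∑ i, C (a i) * X i

lemma eval_lin (a x : Fin 3 → ℂ) : eval x (lin a) = a 0 * x 0 + a 1 * x 1 + a 2 * x 2 := by
  simp [lin, Fin.sum_univ_three]

lemma lin_hom (a : Fin 3 → ℂ) : (lin a).IsHomogeneous 1 :=
  IsHomogeneous.sum _ _ _ fun i _ => (isHomogeneous_X ℂ i).C_mul _

lemma lin_ne {a : Fin 3 → ℂ} (h : a ≠ 0) : lin a ≠ 0 := by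
  intro h0
  apply h
  funext i
  have := eval_lin a (Pi.single i 1)
  rw [h0] at this
  fin_cases i <;> simpa using this.symm

lemma hom0 {F : MvPolynomial (Fin 3) ℂ} (h : F.IsHomogeneous 0) : ∃ c, F = C c :=
  ⟨_, totalDegree_eq_zero_iff_eq_C.1 (by simpa using h.totalDegree_le)⟩

lemma hom1 {F : MvPolynomial (Fin 3) ℂ} (h : F.IsHomogeneous 1) : ∃ a, F = lin a := by
  have e := h.sum_X_mul_pderiv
  choose a ha using fun i => hom0 (h.pderiv (i := i))
  refine ⟨a, ?_⟩
  rw [one_smul] at e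
  rw [← e, lin]
  exact Finset.sum_congr rfl fun i _ => by rw [ha, mul_comm]

lemma hom2 {F : MvPolynomial (Fin 3) ℂ} (h : F.IsHomogeneous 2) : ∃ a b c d e f : ℂ,
    F = C a * X 0 ^ 2 + C b * X 1 ^ 2 + C c * X 2 ^ 2 + C d * X 0 * X 1 + C e * X 0 * X 2 + C f * X 1 * X 2 := by
  have e := h.sum_X_mul_pderiv
  choose a ha using fun i => hom1 (h.pderiv (i := i))
  have e2 : F = C (1/2) * (2 • F) := by
    rw [nsmul_eq_mul, ← mul_assoc, ← map_natCast (C (σ := Fin 3) (R := ℂ)), ← C_mul]; norm_num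
  rw [e2, ← e]
  simp only [ha, lin, Fin.sum_univ_three]
  refine ⟨1/2 * a 0 0, 1/2 * a 1 1, 1/2 * a 2 2, 1/2 * (a 0 1 + a 1 0), 1/2 * (a 0 2 + a 2 0), 1/2 * (a 1 2 + a 2 1), ?_⟩
  simp only [C_mul, C_add]
  ring

lemma hom3 {F : MvPolynomial (Fin 3) ℂ} (h : F.IsHomogeneous 3) : ∃ a : Fin 10 → ℂ,
    F = C (a 0) * X 0 ^ 3 + C (a 1) * X 1 ^ 3 + C (a 2) * X 2 ^ 3 + C (a 3) * X 0 ^ 2 * X 1 + C (a 4) * X 0 ^ 2 * X 2 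
     + C (a 5) * X 1 ^ 2 * X 0 + C (a 6) * X 1 ^ 2 * X 2 + C (a 7) * X 2 ^ 2 * X 0 + C (a 8) * X 2 ^ 2 * X 1 
     + C (a 9) * X 0 * X 1 * X 2 := by
  have e := h.sum_X_mul_pderiv
  choose a b c d e' f ha using fun i => hom2 (h.pderiv (i := i))
  have e2 : F = C (1/3) * (3 • F) := by
    rw [nsmul_eq_mul, ← mul_assoc, ← map_natCast (C (σ := Fin 3) (R := ℂ)), ← C_mul]; norm_num
  rw [e2, ← e]
  simp only [ha, Fin.sum_univ_three]
  refine ⟨![1/3 * a 0, 1/3 * b 1, 1/3 * c 2, 1/3 * (d 0 + a 1), 1/3 * (e' 0 + a 2), 1/3 * (b 0 + d 1), 1/3 * (f 1 + b 2),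
    1/3 * (c 0 + e' 2), 1/3 * (c 1 + f 2), 1/3 * (f 0 + e' 1 + d 2)], ?_⟩
  simp [-one_div, C_mul, C_add]
  ring

open Matrix

lemma mem_plane {u w x : Fin 3 → ℂ} (h : u ⨯₃ w ≠ 0) (hx : eval x (lin (u ⨯₃ w)) = 0) :
    ∃ α β : ℂ, x = α • u + β • w := by
  rw [eval_lin] at hx
  simp only [cross_apply] at hx h
  simp at hx
  by_cases h2 : u 0 * w 1 - u 1 * w 0 ≠ 0
  · have hD := inv_mul_cancel₀ h2
    refine ⟨(u 0 * w 1 - u 1 * w 0)⁻¹ * (x 0 * w 1 - x 1 * w 0), (u 0 * w 1 - u 1 * w 0)⁻¹ * (u 0 * x 1 - u 1 * x 0), ?_⟩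
    funext i; fin_cases i <;> simp
    · linear_combination (-x 0) * hD
    · linear_combination (-x 1) * hD
    · linear_combination (-x 2) * hD + (u 0 * w 1 - u 1 * w 0)⁻¹ * hx
  by_cases h1 : u 2 * w 0 - u 0 * w 2 ≠ 0
  · have hD := inv_mul_cancel₀ h1
    refine ⟨(u 2 * w 0 - u 0 * w 2)⁻¹ * (x 2 * w 0 - x 0 * w 2), (u 2 * w 0 - u 0 * w 2)⁻¹ * (u 2 * x 0 - u 0 * x 2), ?_⟩
    funext i; fin_cases i <;> simp
    · linear_combination (-x 0) * hD
    · linear_combination (-x 1) * hD + (u 2 * w 0 - u 0 * w 2)⁻¹ * hx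
    · linear_combination (-x 2) * hD
  by_cases h0 : u 1 * w 2 - u 2 * w 1 ≠ 0
  · have hD := inv_mul_cancel₀ h0
    refine ⟨(u 1 * w 2 - u 2 * w 1)⁻¹ * (x 1 * w 2 - x 2 * w 1), (u 1 * w 2 - u 2 * w 1)⁻¹ * (u 1 * x 2 - u 2 * x 1), ?_⟩
    funext i; fin_cases i <;> simp
    · linear_combination (-x 0) * hD + (u 1 * w 2 - u 2 * w 1)⁻¹ * hx
    · linear_combination (-x 1) * hD
    · linear_combination (-x 2) * hD
  exfalso
  push Not at h0 h1 h2
  apply h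
  funext i; fin_cases i <;> simp [h0, h1, h2]

lemma lin_dvd {a : Fin 3 → ℂ} (ha : a ≠ 0) {F : MvPolynomial (Fin 3) ℂ}
    (h : ∀ x, eval x (lin a) = 0 → eval x F = 0) : lin a ∣ F := by
  obtain ⟨k, hk⟩ : ∃ k, a k ≠ 0 := by by_contra! hc; exact ha (funext hc)
  let ψ : MvPolynomial (Fin 3) ℂ →ₐ[ℂ] MvPolynomial (Fin 3) ℂ :=
    aeval (fun i => X i - C (if i = k then (a k)⁻¹ else 0) * lin a)
  have h1 : ψ F = 0 := by
    apply MvPolynomial.funext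
    intro x
    have : eval x (ψ F) = eval (fun i => x i - (if i = k then (a k)⁻¹ else 0) * eval x (lin a)) F := by
      have := MvPolynomial.map_aeval (fun i => X i - C (if i = k then (a k)⁻¹ else 0) * lin a) (eval x) F
      rw [this, MvPolynomial.eval]
      congr 2
      · ext a; simp
      · simp
    rw [this, map_zero]
    apply h
    rw [eval_lin, eval_lin]
    fin_cases k <;> simp at hk ⊢ <;> field_simp <;> ring
  have h2 : (Ideal.Quotient.mkₐ ℂ (Ideal.span {lin a})).comp ψ = Ideal.Quotient.mkₐ ℂ (Ideal.span {lin a}) := by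
    apply MvPolynomial.algHom_ext
    intro i
    simp only [AlgHom.comp_apply, ψ, aeval_X, Ideal.Quotient.mkₐ_eq_mk, map_sub, map_mul]
    rw [Ideal.Quotient.eq_zero_iff_mem.2 (Ideal.subset_span rfl : lin a ∈ Ideal.span {lin a})]
    simp
  have h3 := congr($h2 F)
  rw [AlgHom.comp_apply, h1, map_zero] at h3
  exact Ideal.mem_span_singleton.1 (Ideal.Quotient.eq_zero_iff_mem.1 h3.symm)

lemma line_dvd {u w : Fin 3 → ℂ} (h : u ⨯₃ w ≠ 0) {F : MvPolynomial (Fin 3) ℂ}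
    (hF : ∀ α β : ℂ, eval (α • u + β • w) F = 0) : lin (u ⨯₃ w) ∣ F :=
  lin_dvd h fun x hx => by
    obtain ⟨α, β, rfl⟩ := mem_plane h hx
    exact hF α β

lemma not_isUnit_hom {F : MvPolynomial (Fin 3) ℂ} {n : ℕ} (h : F.IsHomogeneous (n + 1)) : ¬ IsUnit F := by
  intro hu
  have := hu.map (constantCoeff (σ := Fin 3) (R := ℂ))
  rw [isUnit_iff_ne_zero] at this
  apply this
  rw [constantCoeff_eq]
  exact h.coeff_eq_zero (by simp)

lemma lin_relPrime {a b : Fin 3 → ℂ} (h : a ⨯₃ b ≠ 0) : IsRelPrime (lin a) (lin b) := by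
  have ha : a ≠ 0 := by rintro rfl; simp at h
  have hb : b ≠ 0 := by rintro rfl; simp at h
  rintro d ⟨e, he⟩ ⟨f, hf⟩
  obtain ⟨m, k, hmk, hd, he'⟩ := hom_factor (he ▸ lin_hom a) (he ▸ lin_ne ha)
  obtain ⟨m', k', hmk', hd', hf'⟩ := hom_factor (hf ▸ lin_hom b) (hf ▸ lin_ne hb)
  have hd0 : d ≠ 0 := by rintro rfl; exact lin_ne ha (by simpa using he)
  have : m = m' := hd.inj_right hd' hd0
  subst this
  rcases m with _ | m
  · obtain ⟨c, rfl⟩ := hom0 hd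
    refine (isUnit_iff_ne_zero.2 ?_).map C
    rintro rfl; simp at hd0
  · have : k = 0 := by omega
    subst this
    have : k' = 0 := by omega
    subst this
    obtain ⟨c, rfl⟩ := hom0 he'
    obtain ⟨c', rfl⟩ := hom0 hf'
    have e0 : ∀ x, c' * eval x (lin a) = c * eval x (lin b) := by
      intro x; rw [he, hf]; simp; ring
    have hc : c ≠ 0 := by rintro rfl; exact lin_ne ha (by simpa using he)
    exfalso; apply h
    have e1 : ∀ i, b i = c' / c * a i := by
      intro i
      have := e0 (Pi.single i 1)
      rw [eval_lin, eval_lin] at this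
      field_simp
      fin_cases i <;> simp at this ⊢ <;> linear_combination -this
    rw [cross_apply]
    funext i
    fin_cases i <;> simp [e1] <;> ring


lemma eval_smul_hom {F : MvPolynomial (Fin 3) ℂ} {n : ℕ} (h : F.IsHomogeneous n) (c : ℂ) (v : Fin 3 → ℂ) :
    eval (c • v) F = c ^ n * eval v F := by
  rw [eval_eq', eval_eq', Finset.mul_sum]
  refine Finset.sum_congr rfl fun d hd => ?_
  have h1 : Finsupp.weight (fun _ => 1) d = n := h (mem_support_iff.1 hd)
  rw [← Finsupp.degree_eq_weight_one, Finsupp.degree_eq_sum] at h1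
  simp only [Pi.smul_apply, smul_eq_mul, mul_pow, Finset.prod_mul_distrib, Finset.prod_pow_eq_pow_sum, h1]
  ring

lemma euler_eval {F : MvPolynomial (Fin 3) ℂ} {n : ℕ} (h : F.IsHomogeneous n) (v : Fin 3 → ℂ) :
    ∑ i, v i * eval v (pderiv i F) = n * eval v F := by
  have := congr(eval v $(h.sum_X_mul_pderiv))
  simpa using this

lemma bertini {F G : MvPolynomial (Fin 3) ℂ} (hF : F.IsHomogeneous 3) (hG : G.IsHomogeneous 3)
    (hF0 : F ≠ 0) (hr : IsRelPrime F G)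
    (hs : ∀ v : Fin 3 → ℂ, v ≠ 0 → ∃ i, eval v (pderiv i F) ≠ 0 ∨ eval v (pderiv i G) ≠ 0) :
    ∃ c : ℂ, ∀ v : Fin 3 → ℂ, v ≠ 0 → ∃ i, eval v (pderiv i (F + C c * G)) ≠ 0 := by
  classical
  by_contra! hcon
  obtain ⟨T, hT, hD⟩ := exists_good {F, G}
  choose v hv0 hv using hcon
  have hv' : ∀ t i, eval (v t) (pderiv i F) + t * eval (v t) (pderiv i G) = 0 := by
    intro t i
    have := hv t i
    simpa [pderiv_C_mul] using this
  have hE : ∀ t, eval (v t) F + t * eval (v t) G = 0 := by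
    intro t
    have e1 := euler_eval hF (v t)
    have e2 := euler_eval hG (v t)
    have : (3:ℂ) * (eval (v t) F + t * eval (v t) G) = 0 := by
      have e3 : ∑ i, v t i * (eval (v t) (pderiv i F) + t * eval (v t) (pderiv i G)) = 0 :=
        Finset.sum_eq_zero fun i _ => by rw [hv', mul_zero]
      simp only [Fin.sum_univ_three] at e1 e2 e3
      push_cast at e1 e2
      linear_combination e3 - e1 - t * e2
    simpa using this
  have hG0 : ∀ t ∈ T, eval (v t) G = 0 := by
    intro t ht
    obtain ⟨D, D0, Da, Dm, Dt, De⟩ := hD t ht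
    have e := congrArg D (hE t)
    rw [Da, Dm, D0, Dt, De F (by simp), De G (by simp)] at e
    have h0 := hv' t 0
    have h1 := hv' t 1
    have h2 := hv' t 2
    simp only [Fin.sum_univ_three] at e
    linear_combination e - D (v t 0) * h0 - D (v t 1) * h1 - D (v t 2) * h2
  have hF0' : ∀ t ∈ T, eval (v t) F = 0 := by
    intro t ht
    have := hE t
    rw [hG0 t ht] at this
    simpa using this
  have hj : ∀ t, ∃ j, v t j ≠ 0 := fun t => Function.ne_iff.1 (hv0 t)
  choose j hj using hj
  have hfin := base_finite F G hF0 hr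
  have hmaps : Set.MapsTo (fun t => ((j t, fun k => v t k / v t (j t)) : Fin 3 × (Fin 3 → ℂ))) T
    {z : Fin 3 × (Fin 3 → ℂ) | ∃ x : Fin 3 → ℂ, x z.1 ≠ 0 ∧ (∀ c:ℂ, eval (c • x) F = 0) ∧ (∀ c:ℂ, eval (c • x) G = 0) ∧ ∀ k, z.2 k = x k / x z.1} :=
    (fun t ht => ⟨v t, hj t, fun c => by rw [eval_smul_hom hF, hF0' t ht, mul_zero],
      fun c => by rw [eval_smul_hom hG, hG0 t ht, mul_zero], fun k => rfl⟩ )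
  obtain ⟨t, ht, t', ht', hne, heq⟩ := hT.exists_ne_map_eq_of_mapsTo hmaps hfin
  simp only [Prod.mk.injEq] at heq
  obtain ⟨e1, e2⟩ := heq
  have e3 : v t' = (v t' (j t') / v t (j t)) • v t := by
    funext k
    have := congrFun e2 k
    have a1 := hj t
    have a2 := hj t'
    rw [div_eq_div_iff a1 a2] at this
    simp only [Pi.smul_apply, smul_eq_mul]
    field_simp
    linear_combination -this
  have hc : v t' (j t') / v t (j t) ≠ 0 := div_ne_zero (hj t') (hj t)
  obtain ⟨i, hi⟩ := hs (v t) (hv0 t)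
  have a := hv' t i
  have b := hv' t' i
  rw [e3, eval_smul_hom hF.pderiv, eval_smul_hom hG.pderiv] at b
  have b' : eval (v t) (pderiv i F) + t' * eval (v t) (pderiv i G) = 0 := by
    apply mul_left_cancel₀ (pow_ne_zero (3-1) hc)
    linear_combination b
  have g0 : eval (v t) (pderiv i G) = 0 := by
    apply mul_left_cancel₀ (sub_ne_zero.2 hne)
    linear_combination a - b'
  rw [g0] at a
  simp at a
  tauto


lemma cross_zero {v w : Fin 3 → ℂ} (hv : v ≠ 0) (h : v ⨯₃ w = 0) : ∃ c : ℂ, w = c • v := by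
  by_contra! hc
  refine (crossProduct_ne_zero_iff_linearIndependent.2 ((LinearIndependent.pair_iff' hv).2 ?_)) h
  intro a ha
  exact hc a ha.symm

lemma cross_self_smul (a b : ℂ) (v : Fin 3 → ℂ) : (a • v) ⨯₃ (b • v) = 0 := by
  simp

lemma dvd_hom {A B : MvPolynomial (Fin 3) ℂ} {m n : ℕ} (hA : A.IsHomogeneous m) (hB : B.IsHomogeneous n)
    (h : A ∣ B) (hmn : n < m) : B = 0 := by
  by_contra h0
  obtain ⟨D, rfl⟩ := h
  obtain ⟨m', k, e, h1, h2⟩ := hom_factor hB h0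
  have := hA.inj_right h1 (left_ne_zero_of_mul h0)
  omega

/-- polar -/
def pol (v : Fin 3 → ℂ) (F : MvPolynomial (Fin 3) ℂ) : MvPolynomial (Fin 3) ℂ :=
  ∑ i, C (v i) * pderiv i F

lemma pol_hom (v : Fin 3 → ℂ) {F : MvPolynomial (Fin 3) ℂ} (h : F.IsHomogeneous 3) : (pol v F).IsHomogeneous 2 :=
  IsHomogeneous.sum _ _ _ fun _ _ => (h.pderiv).C_mul _

lemma eval_pol (v w : Fin 3 → ℂ) (F : MvPolynomial (Fin 3) ℂ) :
    eval w (pol v F) = ∑ i, v i * eval w (pderiv i F) := by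
  simp [pol]

set_option maxHeartbeats 1000000 in
lemma cubic_line {F : MvPolynomial (Fin 3) ℂ} (h : F.IsHomogeneous 3) (v w : Fin 3 → ℂ) (α β : ℂ) :
    eval (α • v + β • w) F = α ^ 3 * eval v F + α ^ 2 * β * eval v (pol w F) + α * β ^ 2 * eval w (pol v F)
      + β ^ 3 * eval w F := by
  obtain ⟨a, rfl⟩ := hom3 h
  simp [eval_pol, Fin.sum_univ_three, pderiv_X, Pi.single_apply]
  ring

set_option maxHeartbeats 1000000 in
lemma pol_line {F : MvPolynomial (Fin 3) ℂ} (h : F.IsHomogeneous 3) (v w : Fin 3 → ℂ) (α β : ℂ) :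
    eval (α • v + β • w) (pol v F) = 3 * α ^ 2 * eval v F + 2 * α * β * eval v (pol w F) + β ^ 2 * eval w (pol v F) := by
  obtain ⟨a, rfl⟩ := hom3 h
  simp [eval_pol, Fin.sum_univ_three, pderiv_X, Pi.single_apply]
  ring

lemma sing_eval {F : MvPolynomial (Fin 3) ℂ} (h : F.IsHomogeneous 3) {v : Fin 3 → ℂ}
    (hs : ∀ i, eval v (pderiv i F) = 0) : eval v F = 0 := by
  have := euler_eval h v
  simpa [hs] using this

lemma sing_line {F : MvPolynomial (Fin 3) ℂ} (h : F.IsHomogeneous 3) {v : Fin 3 → ℂ}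
    (hs : ∀ i, eval v (pderiv i F) = 0) (w : Fin 3 → ℂ) (α β : ℂ) :
    eval (α • v + β • w) F = α * β ^ 2 * eval w (pol v F) + β ^ 3 * eval w F := by
  rw [cubic_line h, sing_eval h hs, eval_pol w v]; simp [hs]

lemma sing_pol {F : MvPolynomial (Fin 3) ℂ} (h : F.IsHomogeneous 3) {v : Fin 3 → ℂ}
    (hs : ∀ i, eval v (pderiv i F) = 0) (w : Fin 3 → ℂ) (α β : ℂ) :
    eval (α • v + β • w) (pol v F) = β ^ 2 * eval w (pol v F) := by
  rw [pol_line h, sing_eval h hs, eval_pol w v]; simp [hs]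

lemma triple_cross (v a b : Fin 3 → ℂ) : (v ⨯₃ a) ⨯₃ (v ⨯₃ b) = (eval b (lin (v ⨯₃ a))) • v := by
  rw [eval_lin]
  simp only [cross_apply]
  funext i; fin_cases i <;> simp <;> ring

lemma not_both_dvd {F G : MvPolynomial (Fin 3) ℂ} (hr : IsRelPrime F G) {a : Fin 3 → ℂ}
    (h1 : lin a ∣ F) (h2 : lin a ∣ G) : False :=
  not_isUnit_hom (n := 0) (lin_hom a) (hr h1 h2)

lemma no_common_sing {F G : MvPolynomial (Fin 3) ℂ} (hF : F.IsHomogeneous 3) (hG : G.IsHomogeneous 3)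
    (hr : IsRelPrime F G) (w : Fin 8 → Fin 3 → ℂ) (hw : ∀ i j, i ≠ j → w i ⨯₃ w j ≠ 0)
    (wF : ∀ i, eval (w i) F = 0) (wG : ∀ i, eval (w i) G = 0) {v : Fin 3 → ℂ} (hv : v ≠ 0)
    (sF : ∀ i, eval v (pderiv i F) = 0) (sG : ∀ i, eval v (pderiv i G) = 0) : False := by
  classical
  obtain ⟨s, hs, hs'⟩ : ∃ s : Finset (Fin 8), 6 ≤ s.card ∧ ∀ i ∈ s, v ⨯₃ w i ≠ 0 := by
    by_cases hex : ∃ i, v ⨯₃ w i = 0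
    · obtain ⟨i, hi⟩ := hex
      refine ⟨Finset.univ.erase i, by simp, fun j hj hj0 => ?_⟩
      obtain ⟨c, hc⟩ := cross_zero hv hi
      obtain ⟨d, hd⟩ := cross_zero hv hj0
      apply hw i j (Finset.ne_of_mem_erase hj).symm
      rw [hc, hd, cross_self_smul]
    · push Not at hex
      exact ⟨Finset.univ, by simp, fun i _ => hex i⟩
  have key : ∀ i ∈ s, ∀ j ∈ s, i ≠ j → (v ⨯₃ w i) ⨯₃ (v ⨯₃ w j) ≠ 0 := by
    intro i hi j hj hij h0
    rw [triple_cross, smul_eq_zero, or_iff_left hv] at h0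
    obtain ⟨α, β, e⟩ := mem_plane (hs' i hi) h0
    have hα : α ≠ 0 := by
      rintro rfl
      apply hw i j hij
      rw [e]; simp
    have hβ : β ≠ 0 := by
      rintro rfl
      apply hs' j hj
      rw [e]; simp
    have aux : ∀ {P : MvPolynomial (Fin 3) ℂ}, P.IsHomogeneous 3 → (∀ i, eval (w i) P = 0) →
        (∀ i, eval v (pderiv i P) = 0) → lin (v ⨯₃ w i) ∣ P := by
      intro P hP wP sP
      apply line_dvd (hs' i hi)
      have h1 := wP j
      rw [e, sing_line hP sP, wP i] at h1
      have h2 : eval (w i) (pol v P) = 0 := by simpa [hα, hβ] using h1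
      intro α β
      rw [sing_line hP sP, wP i, h2]; simp
    exact not_both_dvd hr (aux hF wF sF) (aux hG wG sG)
  set R := pol v F * G - pol v G * F with hR
  have hRh : R.IsHomogeneous 5 := ((pol_hom v hF).mul hG).sub ((pol_hom v hG).mul hF)
  have hdvd : ∏ i ∈ s, lin (v ⨯₃ w i) ∣ R := by
    apply Finset.prod_dvd_of_isRelPrime
    · intro i hi j hj hij
      exact lin_relPrime (key i hi j hj hij)
    · intro i hi
      apply line_dvd (hs' i hi)
      intro α β
      rw [hR, map_sub, map_mul, map_mul, sing_line hF sF, sing_line hG sG, sing_pol hF sF, sing_pol hG sG, wF, wG]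
      ring
  have hR0 : R = 0 := by
    refine dvd_hom (m := s.card) ?_ hRh hdvd (by omega)
    have := IsHomogeneous.prod s (fun i => lin (v ⨯₃ w i)) (fun _ => 1) (fun i _ => lin_hom _)
    simpa using this
  have e0 : pol v F * G = pol v G * F := sub_eq_zero.1 hR0
  have pF : pol v F = 0 := by
    refine dvd_hom hF (pol_hom v hF) (hr.dvd_of_dvd_mul_right (Dvd.intro_left (pol v G) e0.symm)) (by norm_num)
  have pG : pol v G = 0 := by
    refine dvd_hom hG (pol_hom v hG) (hr.symm.dvd_of_dvd_mul_right (Dvd.intro_left (pol v F) e0)) (by norm_num)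
  obtain ⟨i, hi⟩ : s.Nonempty := Finset.card_pos.1 (by omega)
  refine not_both_dvd hr (line_dvd (hs' i hi) ?_) (line_dvd (hs' i hi) ?_)
  · intro α β; rw [sing_line hF sF, pF, wF]; simp
  · intro α β; rw [sing_line hG sG, pG, wG]; simp


/-- cubic from coefficients -/
def cub (a : Fin 10 → ℂ) : MvPolynomial (Fin 3) ℂ :=
  C (a 0) * X 0 ^ 3 + C (a 1) * X 1 ^ 3 + C (a 2) * X 2 ^ 3 + C (a 3) * X 0 ^ 2 * X 1 + C (a 4) * X 0 ^ 2 * X 2 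
     + C (a 5) * X 1 ^ 2 * X 0 + C (a 6) * X 1 ^ 2 * X 2 + C (a 7) * X 2 ^ 2 * X 0 + C (a 8) * X 2 ^ 2 * X 1 
     + C (a 9) * X 0 * X 1 * X 2

lemma cub_hom (a : Fin 10 → ℂ) : (cub a).IsHomogeneous 3 := by
  have hX : ∀ i : Fin 3, (X i : MvPolynomial (Fin 3) ℂ).IsHomogeneous 1 := fun i => isHomogeneous_X ℂ i
  have hC : ∀ c : ℂ, (C c : MvPolynomial (Fin 3) ℂ).IsHomogeneous 0 := fun c => isHomogeneous_C _ c
  have h3 : ∀ (c : ℂ) i, (C c * X i ^ 3 : MvPolynomial (Fin 3) ℂ).IsHomogeneous 3 := fun c i =>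
    (hC c).mul ((hX i).pow 3)
  have h21 : ∀ (c : ℂ) i j, (C c * X i ^ 2 * X j : MvPolynomial (Fin 3) ℂ).IsHomogeneous 3 := fun c i j =>
    ((hC c).mul ((hX i).pow 2)).mul (hX j)
  have h111 : ∀ (c : ℂ) i j k, (C c * X i * X j * X k : MvPolynomial (Fin 3) ℂ).IsHomogeneous 3 := fun c i j k =>
    (((hC c).mul (hX i)).mul (hX j)).mul (hX k)
  exact (((((((((h3 _ _).add (h3 _ _)).add (h3 _ _)).add (h21 _ _ _)).add (h21 _ _ _)).add (h21 _ _ _)).add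
    (h21 _ _ _)).add (h21 _ _ _)).add (h21 _ _ _)).add (h111 _ _ _ _)

lemma eval_cub (a : Fin 10 → ℂ) (x : Fin 3 → ℂ) : eval x (cub a) =
  a 0 * x 0 ^ 3 + a 1 * x 1 ^ 3 + a 2 * x 2 ^ 3 + a 3 * x 0 ^ 2 * x 1 + a 4 * x 0 ^ 2 * x 2 
     + a 5 * x 1 ^ 2 * x 0 + a 6 * x 1 ^ 2 * x 2 + a 7 * x 2 ^ 2 * x 0 + a 8 * x 2 ^ 2 * x 1 
     + a 9 * x 0 * x 1 * x 2 := by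
  simp [cub]

lemma cub_inj {a : Fin 10 → ℂ} (h : cub a = 0) : a = 0 := by
  have e : ∀ x y z : ℂ, a 0 * x ^ 3 + a 1 * y ^ 3 + a 2 * z ^ 3 + a 3 * x ^ 2 * y + a 4 * x ^ 2 * z 
     + a 5 * y ^ 2 * x + a 6 * y ^ 2 * z + a 7 * z ^ 2 * x + a 8 * z ^ 2 * y 
     + a 9 * x * y * z = 0 := by
    intro x y z
    have := eval_cub a ![x, y, z]
    rw [h] at this
    simpa using this.symm
  have h0 : a 0 = 0 := by linear_combination e 1 0 0
  have h1 : a 1 = 0 := by linear_combination e 0 1 0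
  have h2 : a 2 = 0 := by linear_combination e 0 0 1
  have h3 : a 3 = 0 := by linear_combination (e 1 1 0 - e 1 (-1) 0) / 2 - h1
  have h5 : a 5 = 0 := by linear_combination (e 1 1 0 + e 1 (-1) 0) / 2 - h0
  have h4 : a 4 = 0 := by linear_combination (e 1 0 1 - e 1 0 (-1)) / 2 - h2
  have h7 : a 7 = 0 := by linear_combination (e 1 0 1 + e 1 0 (-1)) / 2 - h0
  have h6 : a 6 = 0 := by linear_combination (e 0 1 1 - e 0 1 (-1)) / 2 - h2
  have h8 : a 8 = 0 := by linear_combination (e 0 1 1 + e 0 1 (-1)) / 2 - h1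
  have h9 : a 9 = 0 := by linear_combination e 1 1 1 - h0 - h1 - h2 - h3 - h4 - h5 - h6 - h7 - h8
  funext i
  fin_cases i <;> simp [*]

lemma exists_cubic (w : Fin 8 → Fin 3 → ℂ) (y : Fin 3 → ℂ) : ∃ F : MvPolynomial (Fin 3) ℂ, F ≠ 0 ∧ F.IsHomogeneous 3 ∧
    (∀ i, eval (w i) F = 0) ∧ eval y F = 0 := by
  let f : (Fin 10 → ℂ) →ₗ[ℂ] (Option (Fin 8) → ℂ) :=
    { toFun := fun a i => eval (i.elim y w) (cub a)
      map_add' := fun a b => by funext i; simp only [eval_cub, Pi.add_apply]; ring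
      map_smul' := fun c b => by funext i; simp only [eval_cub, Pi.smul_apply, smul_eq_mul, RingHom.id_apply]; ring }
  have h := LinearMap.ker_ne_bot_of_finrank_lt (f := f) (by simp)
  obtain ⟨a, ha, ha0⟩ := (Submodule.ne_bot_iff _).1 h
  have ha' : f a = 0 := ha
  exact ⟨cub a, fun h => ha0 (cub_inj h), cub_hom a, fun i => congrFun ha' (some i), congrFun ha' none⟩

lemma linear_line {A : MvPolynomial (Fin 3) ℂ} (h : A.IsHomogeneous 1) (u w : Fin 3 → ℂ) (α β : ℂ) :
    eval (α • u + β • w) A = α * eval u A + β * eval w A := by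
  obtain ⟨a, rfl⟩ := hom1 h
  simp [eval_lin]; ring

lemma conic_line {A : MvPolynomial (Fin 3) ℂ} (h : A.IsHomogeneous 2) {u w : Fin 3 → ℂ} 
    (hu : eval u A = 0) (hw : eval w A = 0) (α β : ℂ) :
    eval (α • u + β • w) A = α * β * eval (u + w) A := by
  obtain ⟨a, b, c, d, e, f, rfl⟩ := hom2 h
  simp at hu hw ⊢
  linear_combination (α ^ 2 - α * β) * hu + (β ^ 2 - α * β) * hw

lemma K1 {A B : MvPolynomial (Fin 3) ℂ} (hA : A.IsHomogeneous 1) (hB : B.IsHomogeneous 1) (hr : IsRelPrime A B)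
    {u w : Fin 3 → ℂ} (h : u ⨯₃ w ≠ 0) (Au : eval u A = 0) (Aw : eval w A = 0) (Bu : eval u B = 0) 
    (Bw : eval w B = 0) : False := by
  refine not_both_dvd hr (line_dvd h ?_) (line_dvd h ?_)
  · intro α β; rw [linear_line hA, Au, Aw]; simp
  · intro α β; rw [linear_line hB, Bu, Bw]; simp

lemma line_unique {L : MvPolynomial (Fin 3) ℂ} (hL : L.IsHomogeneous 1) (hL0 : L ≠ 0) {u w x : Fin 3 → ℂ} (h : u ⨯₃ w ≠ 0)
    (Lu : eval u L = 0) (Lw : eval w L = 0) (Lx : eval x L = 0) : eval x (lin (u ⨯₃ w)) = 0 := by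
  have : lin (u ⨯₃ w) ∣ L := line_dvd h fun α β => by rw [linear_line hL, Lu, Lw]; simp
  obtain ⟨N, rfl⟩ := this
  obtain ⟨m, k, e, h1, h2⟩ := hom_factor hL hL0
  have := (lin_hom _).inj_right h1 (lin_ne h)
  obtain rfl : k = 0 := by omega
  obtain ⟨c, rfl⟩ := hom0 h2
  have hc : c ≠ 0 := by rintro rfl; simp at hL0
  simpa [hc] using Lx

lemma K2 {A B : MvPolynomial (Fin 3) ℂ} (hA : A.IsHomogeneous 2) (hB : B.IsHomogeneous 2) (hr : IsRelPrime A B)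
    {s : Finset (Fin 8)} (hs : 5 ≤ s.card) {w : Fin 8 → Fin 3 → ℂ} (hw : ∀ i ∈ s, ∀ j ∈ s, i ≠ j → w i ⨯₃ w j ≠ 0)
    (wA : ∀ i ∈ s, eval (w i) A = 0) (wB : ∀ i ∈ s, eval (w i) B = 0) : False := by
  classical
  have h3 : ∀ i ∈ s, ∀ j ∈ s, ∀ k ∈ s, i ≠ j → i ≠ k → j ≠ k → eval (w k) (lin (w i ⨯₃ w j)) ≠ 0 := by
    intro i hi j hj k hk hij hik hjk h0
    obtain ⟨α, β, e⟩ := mem_plane (hw i hi j hj hij) h0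
    have hα : α ≠ 0 := by
      rintro rfl
      apply hw j hj k hk hjk
      rw [e]; simp
    have hβ : β ≠ 0 := by
      rintro rfl
      apply hw i hi k hk hik
      rw [e]; simp
    have aux : ∀ {P : MvPolynomial (Fin 3) ℂ}, P.IsHomogeneous 2 → (∀ i ∈ s, eval (w i) P = 0) →
        lin (w i ⨯₃ w j) ∣ P := by
      intro P hP wP
      apply line_dvd (hw i hi j hj hij)
      have h1 := wP k hk
      rw [e, conic_line hP (wP i hi) (wP j hj)] at h1
      have h2 : eval (w i + w j) P = 0 := by simpa [hα, hβ] using h1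
      intro α β
      rw [conic_line hP (wP i hi) (wP j hj), h2]; simp
    exact not_both_dvd hr (aux hA wA) (aux hB wB)
  obtain ⟨t, hts, ht⟩ := Finset.exists_subset_card_eq hs
  let e := t.equivFinOfCardEq ht
  let g : Fin 5 → Fin 8 := fun i => (e.symm i : Fin 8)
  have hg : ∀ i, g i ∈ s := fun i => hts (e.symm i).2
  have gi : ∀ {i j}, i ≠ j → g i ≠ g j := by
    intro i j hij h
    exact hij (e.symm.injective (Subtype.ext h))
  have h01 := hw _ (hg 0) _ (hg 1) (gi (by decide))
  set u := w (g 0) + w (g 1) with hu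
  set P := C (eval u B) * A - C (eval u A) * B with hP
  have hPh : P.IsHomogeneous 2 := (hA.C_mul _).sub (hB.C_mul _)
  have wP : ∀ i ∈ s, eval (w i) P = 0 := by
    intro i hi
    rw [hP]; simp [wA i hi, wB i hi]
  have hdvd : lin (w (g 0) ⨯₃ w (g 1)) ∣ P := by
    apply line_dvd h01
    intro α β
    rw [conic_line hPh (wP _ (hg 0)) (wP _ (hg 1)), ← hu, hP]
    simp; right; ring
  have hP0 : P = 0 := by
    by_contra hne
    obtain ⟨N, hN⟩ := hdvd
    obtain ⟨m, k, emk, h1, h2⟩ := hom_factor (hN ▸ hPh) (hN ▸ hne)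
    have := (lin_hom _).inj_right h1 (lin_ne h01)
    obtain rfl : k = 1 := by omega
    have hN0 : N ≠ 0 := by rintro rfl; exact hne (by simpa using hN)
    have hNz : ∀ i, i ≠ 0 → i ≠ 1 → eval (w (g i)) N = 0 := by
      intro i i0 i1
      have := wP _ (hg i)
      rw [hN, map_mul] at this
      exact (mul_eq_zero.1 this).resolve_left (h3 _ (hg 0) _ (hg 1) _ (hg i) (gi (by decide)) (gi i0.symm) (gi i1.symm))
    exact h3 _ (hg 2) _ (hg 3) _ (hg 4) (gi (by decide)) (gi (by decide)) (gi (by decide))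
      (line_unique h2 hN0 (hw _ (hg 2) _ (hg 3) (gi (by decide))) (hNz 2 (by decide) (by decide))
        (hNz 3 (by decide) (by decide)) (hNz 4 (by decide) (by decide)))
  have e0 : C (eval u B) * A = C (eval u A) * B := sub_eq_zero.1 hP0
  have uB : eval u B = 0 := by
    by_contra hne
    refine not_isUnit_hom (n := 1) hB (hr ?_ dvd_rfl)
    have hu : IsUnit (C (eval u B) : MvPolynomial (Fin 3) ℂ) := (isUnit_iff_ne_zero.2 hne).map C
    exact (hu.dvd_mul_left).1 (Dvd.intro_left _ e0.symm)
  have uA : eval u A = 0 := by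
    by_contra hne
    refine not_isUnit_hom (n := 1) hA (hr dvd_rfl ?_)
    have hu : IsUnit (C (eval u A) : MvPolynomial (Fin 3) ℂ) := (isUnit_iff_ne_zero.2 hne).map C
    exact (hu.dvd_mul_left).1 (Dvd.intro_left _ e0)
  refine not_both_dvd hr (line_dvd h01 ?_) (line_dvd h01 ?_)
  · intro α β; rw [conic_line hA (wA _ (hg 0)) (wA _ (hg 1)), ← hu, uA, mul_zero]
  · intro α β; rw [conic_line hB (wB _ (hg 0)) (wB _ (hg 1)), ← hu, uB, mul_zero]

lemma reduce {F G : MvPolynomial (Fin 3) ℂ} {n : ℕ} (hF : F.IsHomogeneous n) (hG : G.IsHomogeneous n) 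
    (hF0 : F ≠ 0) (hG0 : G ≠ 0) : ∃ (H A B : MvPolynomial (Fin 3) ℂ) (m k : ℕ), m + k = n ∧ H ≠ 0 ∧ IsRelPrime A B ∧
      H.IsHomogeneous m ∧ A.IsHomogeneous k ∧ B.IsHomogeneous k ∧ F = H * A ∧ G = H * B ∧ A ≠ 0 ∧ B ≠ 0 := by
  obtain ⟨A, B, H, hr, rfl, rfl⟩ := UniqueFactorizationMonoid.exists_reduced_factors F hF0 G
  obtain ⟨m, k, e, h1, h2⟩ := hom_factor hF hF0
  obtain ⟨m', k', e', h1', h2'⟩ := hom_factor hG hG0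
  have hH := left_ne_zero_of_mul hF0
  have := h1.inj_right h1' hH
  obtain rfl : k = k' := by omega
  exact ⟨H, A, B, m, k, e, hH, hr, h1, h2, h2', rfl, rfl, right_ne_zero_of_mul hF0, right_ne_zero_of_mul hG0⟩

lemma conic_unique {A B : MvPolynomial (Fin 3) ℂ} (hA : A.IsHomogeneous 2) (hB : B.IsHomogeneous 2) (hA0 : A ≠ 0) (hB0 : B ≠ 0)
    {s : Finset (Fin 8)} (hs : 5 ≤ s.card) {w : Fin 8 → Fin 3 → ℂ} (hw : ∀ i ∈ s, ∀ j ∈ s, i ≠ j → w i ⨯₃ w j ≠ 0)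
    (h4 : ∀ L : MvPolynomial (Fin 3) ℂ, L ≠ 0 → L.IsHomogeneous 1 → ∀ t ⊆ s, (∀ i ∈ t, eval (w i) L = 0) → t.card ≤ 3)
    (wA : ∀ i ∈ s, eval (w i) A = 0) (wB : ∀ i ∈ s, eval (w i) B = 0) : ∃ c, A = C c * B := by
  classical
  obtain ⟨H, a, b, m, k, e, hH0, hr, hH, ha, hb, rfl, rfl, ha0, hb0⟩ := reduce hA hB hA0 hB0
  simp only [map_mul, mul_eq_zero] at wA wB
  obtain rfl | rfl | rfl : k = 0 ∨ k = 1 ∨ k = 2 := by omega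
  · obtain ⟨α, rfl⟩ := hom0 ha
    obtain ⟨β, rfl⟩ := hom0 hb
    have hβ : β ≠ 0 := by rintro rfl; simp at hb0
    refine ⟨α / β, ?_⟩
    rw [mul_comm H, mul_comm H, ← mul_assoc, ← C_mul, div_mul_cancel₀ _ hβ]
  · obtain rfl : m = 1 := by omega
    have c1 := h4 H hH0 hH (s.filter fun i => eval (w i) H = 0) (Finset.filter_subset _ _) (by simp)
    have c2 := Finset.card_filter_add_card_filter_not (s := s) (fun i => eval (w i) H = 0)
    obtain ⟨i, hi, j, hj, hij⟩ := Finset.one_lt_card.1 (show 1 < (s.filter fun i => ¬ eval (w i) H = 0).card by omega)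
    simp only [Finset.mem_filter] at hi hj
    exact (K1 ha hb hr (hw i hi.1 j hj.1 hij) ((wA i hi.1).resolve_left hi.2) ((wA j hj.1).resolve_left hj.2)
      ((wB i hi.1).resolve_left hi.2) ((wB j hj.1).resolve_left hj.2)).elim
  · obtain rfl : m = 0 := by omega
    obtain ⟨c, rfl⟩ := hom0 hH
    have hc : c ≠ 0 := by rintro rfl; simp at hH0
    exact (K2 ha hb hr hs hw (fun i hi => (wA i hi).resolve_left (by simpa using hc)) 
      (fun i hi => (wB i hi).resolve_left (by simpa using hc))).elim

lemma cubic_relPrime {F G : MvPolynomial (Fin 3) ℂ} (hF : F.IsHomogeneous 3) (hG : G.IsHomogeneous 3) (hF0 : F ≠ 0) (hG0 : G ≠ 0)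
    (hne : ∀ c, F ≠ C c * G)
    {w : Fin 8 → Fin 3 → ℂ} (hw : ∀ i j, i ≠ j → w i ⨯₃ w j ≠ 0)
    (h4 : ∀ L : MvPolynomial (Fin 3) ℂ, L ≠ 0 → L.IsHomogeneous 1 → ∀ t : Finset (Fin 8), (∀ i ∈ t, eval (w i) L = 0) → t.card ≤ 3)
    (h7 : ∀ L : MvPolynomial (Fin 3) ℂ, L ≠ 0 → L.IsHomogeneous 2 → ∀ t : Finset (Fin 8), (∀ i ∈ t, eval (w i) L = 0) → t.card ≤ 6)
    (wA : ∀ i, eval (w i) F = 0) (wB : ∀ i, eval (w i) G = 0) : IsRelPrime F G := by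
  classical
  obtain ⟨H, a, b, m, k, e, hH0, hr, hH, ha, hb, rfl, rfl, ha0, hb0⟩ := reduce hF hG hF0 hG0
  simp only [map_mul, mul_eq_zero] at wA wB
  have c2 := Finset.card_filter_add_card_filter_not (s := (Finset.univ : Finset (Fin 8))) (fun i => eval (w i) H = 0)
  rw [Finset.card_univ, Fintype.card_fin] at c2
  obtain rfl | rfl | rfl | rfl : k = 0 ∨ k = 1 ∨ k = 2 ∨ k = 3 := by omega
  · exfalso
    obtain ⟨α, rfl⟩ := hom0 ha
    obtain ⟨β, rfl⟩ := hom0 hb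
    have hβ : β ≠ 0 := by rintro rfl; simp at hb0
    refine hne (α / β) ?_
    rw [mul_comm H, mul_comm H, ← mul_assoc, ← C_mul, div_mul_cancel₀ _ hβ]
  · obtain rfl : m = 2 := by omega
    have c1 := h7 H hH0 hH (Finset.univ.filter fun i => eval (w i) H = 0) (by simp)
    obtain ⟨i, hi, j, hj, hij⟩ := Finset.one_lt_card.1 (show 1 < (Finset.univ.filter fun i => ¬ eval (w i) H = 0).card by omega)
    simp only [Finset.mem_filter] at hi hj
    exact (K1 ha hb hr (hw i j hij) ((wA i).resolve_left hi.2) ((wA j).resolve_left hj.2)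
      ((wB i).resolve_left hi.2) ((wB j).resolve_left hj.2)).elim
  · obtain rfl : m = 1 := by omega
    have c1 := h4 H hH0 hH (Finset.univ.filter fun i => eval (w i) H = 0) (by simp)
    refine (K2 ha hb hr (show 5 ≤ (Finset.univ.filter fun i => ¬ eval (w i) H = 0).card by omega) (fun i _ j _ => hw i j) ?_ ?_).elim
    · intro i hi; exact (wA i).resolve_left (Finset.mem_filter.1 hi).2
    · intro i hi; exact (wB i).resolve_left (Finset.mem_filter.1 hi).2
  · obtain rfl : m = 0 := by omega
    obtain ⟨c, rfl⟩ := hom0 hH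
    have hc : c ≠ 0 := by rintro rfl; simp at hH0
    have hu : IsUnit (C c : MvPolynomial (Fin 3) ℂ) := (isUnit_iff_ne_zero.2 hc).map C
    intro d h1 h2
    exact hr ((hu.dvd_mul_left).1 h1) ((hu.dvd_mul_left).1 h2)

theorem core {w : Fin 8 → Fin 3 → ℂ} (hw : ∀ i j, i ≠ j → w i ⨯₃ w j ≠ 0)
    (h4 : ∀ L : MvPolynomial (Fin 3) ℂ, L ≠ 0 → L.IsHomogeneous 1 → ∀ t : Finset (Fin 8), (∀ i ∈ t, eval (w i) L = 0) → t.card ≤ 3)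
    (h7 : ∀ L : MvPolynomial (Fin 3) ℂ, L ≠ 0 → L.IsHomogeneous 2 → ∀ t : Finset (Fin 8), (∀ i ∈ t, eval (w i) L = 0) → t.card ≤ 6) :
    ∃ F : MvPolynomial (Fin 3) ℂ, F ≠ 0 ∧ F.IsHomogeneous 3 ∧ (∀ i, eval (w i) F = 0) ∧
      ∀ v : Fin 3 → ℂ, v ≠ 0 → ∃ i, eval v (pderiv i F) ≠ 0 := by
  obtain ⟨F, hF0, hF, wF, -⟩ := exists_cubic w 0
  obtain ⟨y, hy⟩ : ∃ y, eval y F ≠ 0 := by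
    by_contra! h
    exact hF0 (MvPolynomial.funext fun x => by rw [h, map_zero])
  obtain ⟨G, hG0, hG, wG, yG⟩ := exists_cubic w y
  have hr := cubic_relPrime hF hG hF0 hG0 (fun c h => hy (by rw [h, map_mul, yG, mul_zero])) hw h4 h7 wF wG
  obtain ⟨c, hc⟩ := bertini hF hG hF0 hr (by
    intro v hv
    by_contra! h
    exact no_common_sing hF hG hr w hw wF wG hv (fun i => (h i).1) (fun i => (h i).2))
  refine ⟨F + C c * G, ?_, hF.add (hG.C_mul c), fun i => by simp [wF, wG], hc⟩
  intro h0
  obtain ⟨i, hi⟩ := hc (fun _ => 1) (fun h => one_ne_zero (congrFun h 0))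
  rw [h0] at hi
  simp at hi


lemma exists_line (u v : Fin 3 → ℂ) : ∃ a : Fin 3 → ℂ, a ≠ 0 ∧ eval u (lin a) = 0 ∧ eval v (lin a) = 0 := by
  let f : (Fin 3 → ℂ) →ₗ[ℂ] (Fin 2 → ℂ) :=
    { toFun := fun a => ![eval u (lin a), eval v (lin a)]
      map_add' := fun a b => by funext i; fin_cases i <;> simp [eval_lin] <;> ring
      map_smul' := fun c b => by funext i; fin_cases i <;> simp [eval_lin] <;> ring }
  have h := LinearMap.ker_ne_bot_of_finrank_lt (f := f) (by simp)
  obtain ⟨a, ha, ha0⟩ := (Submodule.ne_bot_iff _).1 h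
  have ha' : f a = 0 := ha
  exact ⟨a, ha0, congrFun ha' 0, congrFun ha' 1⟩

theorem core' {w : Fin 8 → Fin 3 → ℂ} (hw0 : ∀ i, w i ≠ 0)
    (h4 : ∀ L : MvPolynomial (Fin 3) ℂ, L ≠ 0 → L.IsHomogeneous 1 → ∀ t : Finset (Fin 8), (∀ i ∈ t, eval (w i) L = 0) → t.card ≤ 3)
    (h7 : ∀ L : MvPolynomial (Fin 3) ℂ, L ≠ 0 → L.IsHomogeneous 2 → ∀ t : Finset (Fin 8), (∀ i ∈ t, eval (w i) L = 0) → t.card ≤ 6) :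
    ∃ F : MvPolynomial (Fin 3) ℂ, F ≠ 0 ∧ F.IsHomogeneous 3 ∧ (∀ i, eval (w i) F = 0) ∧
      ∀ v : Fin 3 → ℂ, v ≠ 0 → ∃ i, eval v (pderiv i F) ≠ 0 := by
  classical
  by_cases hw : ∀ i j, i ≠ j → w i ⨯₃ w j ≠ 0
  · exact core hw h4 h7
  push Not at hw
  obtain ⟨i0, j, hij, hc⟩ := hw
  have sym : ∀ a b, w a ⨯₃ w b = 0 → w b ⨯₃ w a = 0 := by
    intro a b h
    rw [← cross_anticomm, h, neg_zero]
  obtain ⟨c, hc⟩ := cross_zero (hw0 i0) hc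
  have four : ∀ (u v : Fin 3 → ℂ) (a b c d : Fin 8), a ≠ b → a ≠ c → a ≠ d → b ≠ c → b ≠ d → c ≠ d →
      (∀ i ∈ ({a, b, c, d} : Finset (Fin 8)), (∃ r : ℂ, w i = r • u) ∨ ∃ r : ℂ, w i = r • v) → False := by
    intro u v a b c d h1 h2 h3 h4' h5 h6 H
    obtain ⟨l, hl0, hlu, hlv⟩ := exists_line u v
    have := h4 (lin l) (lin_ne hl0) (lin_hom l) {a, b, c, d} (by
      intro i hi
      rcases H i hi with ⟨r, hr⟩ | ⟨r, hr⟩ <;> rw [hr, eval_smul_hom (lin_hom l)] <;> simp [hlu, hlv])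
    rw [Finset.card_eq_of_equiv_fin (n := 4)] at this
    · omega
    · exact Finset.equivFinOfCardEq (by simp [*])
  have hw' : ∀ k l, k ≠ j → l ≠ j → k ≠ l → w k ⨯₃ w l ≠ 0 := by
    intro k l hk hl hkl h0
    obtain ⟨d, hd⟩ := cross_zero (hw0 k) h0
    obtain ⟨d', hd'⟩ := cross_zero (hw0 l) (sym _ _ h0)
    have self : ∀ i, ∃ r : ℂ, w i = r • w i := fun i => ⟨1, by simp⟩
    by_cases hki : k = i0
    · subst hki
      obtain ⟨m, hm⟩ : ∃ m, m ∉ ({k, j, l} : Finset (Fin 8)) := by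
        by_contra! h
        have := Finset.card_le_three (a := k) (b := j) (c := l)
        rw [Finset.eq_univ_iff_forall.2 h] at this
        simp at this
      simp only [Finset.mem_insert, Finset.mem_singleton, not_or] at hm
      refine four (w k) (w m) k j l m hij hkl (Ne.symm hm.1) hl.symm (Ne.symm hm.2.1) (Ne.symm hm.2.2) ?_
      intro i hi
      simp only [Finset.mem_insert, Finset.mem_singleton] at hi
      rcases hi with rfl | rfl | rfl | rfl
      · exact Or.inl (self _)
      · exact Or.inl ⟨_, hc⟩
      · exact Or.inl ⟨_, hd⟩
      · exact Or.inr (self _)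
    by_cases hli : l = i0
    · subst hli
      obtain ⟨m, hm⟩ : ∃ m, m ∉ ({l, j, k} : Finset (Fin 8)) := by
        by_contra! h
        have := Finset.card_le_three (a := l) (b := j) (c := k)
        rw [Finset.eq_univ_iff_forall.2 h] at this
        simp at this
      simp only [Finset.mem_insert, Finset.mem_singleton, not_or] at hm
      refine four (w l) (w m) l j k m hij hkl.symm (Ne.symm hm.1) hk.symm (Ne.symm hm.2.1) (Ne.symm hm.2.2) ?_
      intro i hi
      simp only [Finset.mem_insert, Finset.mem_singleton] at hi
      rcases hi with rfl | rfl | rfl | rfl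
      · exact Or.inl (self _)
      · exact Or.inl ⟨_, hc⟩
      · exact Or.inl ⟨_, hd'⟩
      · exact Or.inr (self _)
    refine four (w i0) (w k) i0 j k l hij (Ne.symm hki) (Ne.symm hli) hk.symm hl.symm hkl ?_
    intro i hi
    simp only [Finset.mem_insert, Finset.mem_singleton] at hi
    rcases hi with rfl | rfl | rfl | rfl
    · exact Or.inl (self _)
    · exact Or.inl ⟨_, hc⟩
    · exact Or.inr (self _)
    · exact Or.inr ⟨_, hd⟩
  have hq : ∀ T : Finset (Fin 8), ∃ q : MvPolynomial (Fin 3) ℂ, q ≠ 0 ∧ (j ∉ T → 6 ≤ T.card → 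
      ∀ Q : MvPolynomial (Fin 3) ℂ, Q ≠ 0 → Q.IsHomogeneous 2 → (∀ i ∈ T, eval (w i) Q = 0) → 
      ∀ x, eval x Q = 0 → eval x q = 0) := by
    intro T
    by_cases hT : j ∉ T ∧ 6 ≤ T.card ∧ ∃ q : MvPolynomial (Fin 3) ℂ, q ≠ 0 ∧ q.IsHomogeneous 2 ∧ ∀ i ∈ T, eval (w i) q = 0
    · obtain ⟨hjT, hT6, q, hq0, hq, wq⟩ := hT
      refine ⟨q, hq0, fun _ _ Q hQ0 hQ wQ x hx => ?_⟩
      obtain ⟨c, hc⟩ := conic_unique hq hQ hq0 hQ0 (s := T) (by omega) (w := w)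
        (fun a ha b hb hab => hw' a b (fun h => hjT (h ▸ ha)) (fun h => hjT (h ▸ hb)) hab)
        (fun L hL0 hL t _ => h4 L hL0 hL t) wq wQ
      rw [hc, map_mul, hx, mul_zero]
    · exact ⟨1, one_ne_zero, fun h1 h2 Q hQ0 hQ wQ => (hT ⟨h1, h2, Q, hQ0, hQ, wQ⟩).elim⟩
  choose q hq0 hq using hq
  have hl : ∀ z : Fin 8 × Fin 8, ∃ q : MvPolynomial (Fin 3) ℂ, q ≠ 0 ∧ (z.1 ≠ j → z.2 ≠ j → z.1 ≠ z.2 → 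
      q = lin (w z.1 ⨯₃ w z.2)) := by
    intro z
    by_cases hz : z.1 ≠ j ∧ z.2 ≠ j ∧ z.1 ≠ z.2
    · exact ⟨_, lin_ne (hw' _ _ hz.1 hz.2.1 hz.2.2), fun _ _ _ => rfl⟩
    · exact ⟨1, one_ne_zero, fun h1 h2 h3 => (hz ⟨h1, h2, h3⟩).elim⟩
  choose l hl0 hl using hl
  obtain ⟨x, hx⟩ : ∃ x, eval x ((∏ T, q T) * ∏ z, l z) ≠ 0 := by
    by_contra! h
    have hne : (∏ T, q T) * ∏ z, l z ≠ 0 :=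
      mul_ne_zero (Finset.prod_ne_zero_iff.2 fun T _ => hq0 T) (Finset.prod_ne_zero_iff.2 fun z _ => hl0 z)
    exact hne (MvPolynomial.funext fun x => by rw [h, map_zero])
  simp only [map_mul, map_prod] at hx
  have hxq : ∀ T, eval x (q T) ≠ 0 := fun T => 
    Finset.prod_ne_zero_iff.1 (left_ne_zero_of_mul hx) T (Finset.mem_univ _)
  have hxl : ∀ a b, a ≠ j → b ≠ j → a ≠ b → eval x (lin (w a ⨯₃ w b)) ≠ 0 := fun a b h1 h2 h3 => by
    rw [← hl (a, b) h1 h2 h3]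
    exact Finset.prod_ne_zero_iff.1 (right_ne_zero_of_mul hx) (a, b) (Finset.mem_univ _)
  have hxw : ∀ a, a ≠ j → w a ⨯₃ x ≠ 0 := by
    intro a ha h0
    obtain ⟨d, hd⟩ := cross_zero (hw0 a) h0
    obtain ⟨m, hm⟩ : ∃ m, m ∉ ({a, j} : Finset (Fin 8)) := by
      by_contra! h
      have := Finset.card_le_two (a := a) (b := j)
      rw [Finset.eq_univ_iff_forall.2 h] at this
      simp at this
    simp only [Finset.mem_insert, Finset.mem_singleton, not_or] at hm
    apply hxl a m ha hm.2 (Ne.symm hm.1)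
    rw [hd, eval_smul_hom (lin_hom _), eval_lin]
    simp only [cross_apply]
    simp
    right; ring
  have hne : ∀ {i}, i ≠ j → Function.update w j x i = w i := fun h => Function.update_of_ne h _ _
  obtain ⟨F, hF0, hF, wF, sF⟩ := core (w := Function.update w j x) (by
      intro a b hab
      by_cases ha : a = j
      · subst ha
        rw [Function.update_self, hne hab.symm]
        intro h
        apply hxw b hab.symm
        rw [← cross_anticomm, h, neg_zero]
      by_cases hb : b = j
      · subst hb
        rw [Function.update_self, hne hab]
        exact hxw a hab
      rw [hne ha, hne hb]
      exact hw' a b ha hb hab) (by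
      intro L hL0 hL t ht
      by_cases hj : j ∈ t
      · by_contra! hcard
        have h1 := Finset.card_erase_of_mem hj
        obtain ⟨a, ha, b, hb, hab⟩ := Finset.one_lt_card.1 (show 1 < (t.erase j).card by omega)
        rw [Finset.mem_erase] at ha hb
        have ea := ht a ha.2
        have eb := ht b hb.2
        have ej := ht j hj
        rw [hne ha.1] at ea
        rw [hne hb.1] at eb
        rw [Function.update_self] at ej
        exact hxl a b ha.1 hb.1 hab (line_unique hL hL0 (hw' a b ha.1 hb.1 hab) ea eb ej)
      · refine h4 L hL0 hL t fun i hi => ?_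
        rw [← hne (show i ≠ j from fun h => hj (h ▸ hi))]
        exact ht i hi) (by
      intro L hL0 hL t ht
      by_cases hj : j ∈ t
      · by_contra! hcard
        have h1 := Finset.card_erase_of_mem hj
        have ej := ht j hj
        rw [Function.update_self] at ej
        refine hxq _ (hq (t.erase j) (Finset.notMem_erase _ _) (by omega) L hL0 hL (fun i hi => ?_) x ej)
        rw [Finset.mem_erase] at hi
        rw [← hne hi.1]
        exact ht i hi.2
      · refine h7 L hL0 hL t fun i hi => ?_
        rw [← hne (show i ≠ j from fun h => hj (h ▸ hi))]
        exact ht i hi)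
  refine ⟨F, hF0, hF, fun i => ?_, sF⟩
  by_cases hi : i = j
  · subst hi
    have := wF i0
    rw [hne hij] at this
    rw [hc, eval_smul_hom hF, this, mul_zero]
  · rw [← hne hi]
    exact wF i


end Helpers

/-- Let `x, x₁, …, x₇` be eight points of `ℙ²` such that no four of them are collinear and
no conic passes through seven of them.  Then there exists a smooth plane cubic passing
through these eight points. -/
theorem exists_smooth_cubic_through_eight_points
    (p : Fin 8 → P2)
    (h4 : ∀ f : Fin 4 ↪ Fin 8, ¬ ∃ L : MvPolynomial (Fin 3) ℂ,
        L ≠ 0 ∧ L.IsHomogeneous 1 ∧ ∀ k, pVanish L (p (f k)))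
    (h7 : ∀ f : Fin 7 ↪ Fin 8, ¬ ∃ Q : MvPolynomial (Fin 3) ℂ,
        Q ≠ 0 ∧ Q.IsHomogeneous 2 ∧ ∀ k, pVanish Q (p (f k))) :
    ∃ F : MvPolynomial (Fin 3) ℂ, F ≠ 0 ∧ F.IsHomogeneous 3 ∧
      (∀ i, pVanish F (p i)) ∧ SmoothPlaneCurve F := by
  classical
  obtain ⟨F, hF0, hF, wF, sF⟩ := core' (w := fun i => (p i).rep) (fun i => (p i).rep_nonzero) (by
      intro L hL0 hL t ht
      by_contra! hcard
      obtain ⟨s, hs, hs4⟩ := Finset.exists_subset_card_eq (show 4 ≤ t.card by omega)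
      exact h4 (s.orderEmbOfFin hs4).toEmbedding
        ⟨L, hL0, hL, fun k => ht _ (hs (Finset.orderEmbOfFin_mem s hs4 k))⟩) (by
      intro L hL0 hL t ht
      by_contra! hcard
      obtain ⟨s, hs, hs4⟩ := Finset.exists_subset_card_eq (show 7 ≤ t.card by omega)
      exact h7 (s.orderEmbOfFin hs4).toEmbedding
        ⟨L, hL0, hL, fun k => ht _ (hs (Finset.orderEmbOfFin_mem s hs4 k))⟩)
  exact ⟨F, hF0, hF, wF, fun q _ => sF _ q.rep_nonzero⟩
end
end

section
/- Let r ≤ 6 and let X_r be the blow-up of the complex projective plane at r distinct points x_1, …, x_r in general position, and let x be a point of X_r in general position. Then there exists an irreducible and reduced member D_x of the anticanonical linear system |−K_{X_r}| with mult_x D_x = 2. -/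
open MvPolynomial

noncomputable section

abbrev MP := MvPolynomial (Fin 3) ℂ

namespace AC

lemma hom0 {F : MP} (h : F.IsHomogeneous 0) : ∃ c : ℂ, F = C c := by
  rw [← totalDegree_zero_iff_isHomogeneous, totalDegree_eq_zero_iff_eq_C] at h
  exact ⟨_, h⟩

lemma homStep {n : ℕ} {F : MP} (h : F.IsHomogeneous (n+1)) :
    ∃ G : Fin 3 → MP, (∀ i, (G i).IsHomogeneous n) ∧ F = ∑ i, X i * G i := by
  refine ⟨fun i => C ((n+1 : ℂ)⁻¹) * pderiv i F, fun i => ?_, ?_⟩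
  · exact IsHomogeneous.C_mul (by simpa using h.pderiv (i := i)) _
  · have e := h.sum_X_mul_pderiv
    have : (n+1 : ℂ) ≠ 0 := by exact_mod_cast Nat.succ_ne_zero n
    calc F = C ((n+1 : ℂ)⁻¹) * ((n+1) • F) := by
          rw [nsmul_eq_mul, ← mul_assoc]
          have : (((n+1 : ℕ)) : MP) = C (n+1 : ℂ) := by simp
          rw [this, ← C_mul, inv_mul_cancel₀ ‹_›]; simp
      _ = _ := by
          rw [← e, Finset.mul_sum]
          exact Finset.sum_congr rfl fun i _ => by ring

lemma hom1 {F : MP} (h : F.IsHomogeneous 1) : ∃ c : Fin 3 → ℂ, F = ∑ i, X i * C (c i) := by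
  obtain ⟨G, hG, e⟩ := homStep h
  choose c hc using fun i => hom0 (hG i)
  exact ⟨c, by simp only [e, ← hc]⟩

lemma hom2 {F : MP} (h : F.IsHomogeneous 2) :
    ∃ c : Fin 3 → Fin 3 → ℂ, F = ∑ i, X i * ∑ j, X j * C (c i j) := by
  obtain ⟨G, hG, e⟩ := homStep h
  choose c hc using fun i => hom1 (hG i)
  exact ⟨c, by simp only [e, ← hc]⟩

lemma hom3 {F : MP} (h : F.IsHomogeneous 3) :
    ∃ c : Fin 3 → Fin 3 → Fin 3 → ℂ, F = ∑ i, X i * ∑ j, X j * ∑ k, X k * C (c i j k) := by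
  obtain ⟨G, hG, e⟩ := homStep h
  choose c hc using fun i => hom2 (hG i)
  exact ⟨c, by simp only [e, ← hc]⟩

lemma quad_line {F : MP} (h : F.IsHomogeneous 2) (a b : Fin 3 → ℂ) (s t : ℂ) :
    eval (s • a + t • b) F = s^2 * eval a F + t^2 * eval b F
      + s * t * ∑ i, b i * eval a (pderiv i F) := by
  obtain ⟨c, rfl⟩ := hom2 h
  simp [Fin.sum_univ_three, pderiv_X, Pi.single_apply]
  ring

lemma cubic_line {F : MP} (h : F.IsHomogeneous 3) (a b : Fin 3 → ℂ) (s t : ℂ) :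
    eval (s • a + t • b) F = s^3 * eval a F + t^3 * eval b F
      + s^2 * t * ∑ i, b i * eval a (pderiv i F) + s * t^2 * ∑ i, a i * eval b (pderiv i F) := by
  obtain ⟨c, rfl⟩ := hom3 h
  simp [Fin.sum_univ_three, pderiv_X, Pi.single_apply]
  ring

lemma cubic_line2 {F : MP} (h : F.IsHomogeneous 3) (a b : Fin 3 → ℂ) (s t : ℂ) :
    eval (s • a + t • b) F = s^3 * eval a F + t^3 * eval b F
      + s^2 * t * ∑ i, b i * eval a (pderiv i F) + s * t^2 * (
      b 0 ^2 / 2 * eval a (pderiv 0 (pderiv 0 F)) + b 1 ^2 / 2 * eval a (pderiv 1 (pderiv 1 F))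
      + b 2 ^2 / 2 * eval a (pderiv 2 (pderiv 2 F))
      + b 0 * b 1 * eval a (pderiv 0 (pderiv 1 F)) + b 0 * b 2 * eval a (pderiv 0 (pderiv 2 F))
      + b 1 * b 2 * eval a (pderiv 1 (pderiv 2 F))) := by
  obtain ⟨c, rfl⟩ := hom3 h
  simp [Fin.sum_univ_three, pderiv_X, Pi.single_apply]
  ring

/-- grading substitution -/
def gr : MP →ₐ[ℂ] Polynomial MP := aeval fun i => Polynomial.C (X i) * Polynomial.X

lemma gr_monomial (d : Fin 3 →₀ ℕ) (c : ℂ) :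
    gr (monomial d c) = Polynomial.monomial d.degree (monomial d c) := by
  have : (monomial d c : MP) = C c * ∏ i, X i ^ d i := by
    rw [monomial_eq, Finsupp.prod_fintype]; simp
  rw [this]
  simp only [gr, map_mul, map_prod, map_pow, aeval_X, mul_pow, Finset.prod_mul_distrib]
  rw [Finset.prod_pow_eq_pow_sum, ← Polynomial.C_mul_X_pow_eq_monomial, Finsupp.degree_eq_sum]
  simp [← mul_assoc, MvPolynomial.algebraMap_eq]

lemma gr_coeff (A : MP) (k : ℕ) : (gr A).coeff k = homogeneousComponent k A := by
  induction A using MvPolynomial.induction_on' with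
  | monomial d c =>
    rw [gr_monomial, Polynomial.coeff_monomial]
    rw [homogeneousComponent_of_mem (m := k) (isHomogeneous_monomial c rfl)]
    simp [eq_comm]
  | add p q hp hq => simp [hp, hq]

lemma hom_factor {A B : MP} {n : ℕ} (h : (A * B).IsHomogeneous n) (h0 : A * B ≠ 0) :
    ∃ i j, i + j = n ∧ A.IsHomogeneous i ∧ B.IsHomogeneous j := by
  have inj : ∀ P : MP, P ≠ 0 → gr P ≠ 0 := by
    intro P hP h
    apply hP
    rw [← sum_homogeneousComponent P]
    exact Finset.sum_eq_zero fun i _ => by rw [← gr_coeff, h]; simp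
  have hAB : gr A * gr B = Polynomial.monomial n (A * B) := by
    rw [← map_mul]
    ext1 k
    rw [gr_coeff, homogeneousComponent_of_mem (m := k) h, Polynomial.coeff_monomial]
    simp [eq_comm]
  have hA := inj A (left_ne_zero_of_mul h0)
  have hB := inj B (right_ne_zero_of_mul h0)
  have h1 := Polynomial.natDegree_mul hA hB
  have h2 := Polynomial.natTrailingDegree_mul hA hB
  rw [hAB, Polynomial.natDegree_monomial_eq _ h0] at h1
  rw [hAB, Polynomial.natTrailingDegree_monomial h0] at h2
  have h3 := (gr A).natTrailingDegree_le_natDegree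
  have h4 := (gr B).natTrailingDegree_le_natDegree
  have key : ∀ P : MP, (gr P).natTrailingDegree = (gr P).natDegree →
      P.IsHomogeneous (gr P).natDegree := by
    intro P hP
    rw [← sum_homogeneousComponent P]
    generalize hm : (gr (∑ i ∈ Finset.range (P.totalDegree + 1), homogeneousComponent i P)).natDegree = m
    rw [sum_homogeneousComponent] at hm
    apply IsHomogeneous.sum
    intro i _
    by_cases hi : i = m
    · subst hi; exact homogeneousComponent_isHomogeneous _ _
    · have : homogeneousComponent i P = 0 := by
        rw [← gr_coeff]
        rcases lt_or_gt_of_ne hi with h | h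
        · exact Polynomial.coeff_eq_zero_of_lt_natTrailingDegree (by omega)
        · exact Polynomial.coeff_eq_zero_of_natDegree_lt (by omega)
      rw [this]; exact isHomogeneous_zero _ _ _
  exact ⟨_, _, h1.symm, key A (by omega), key B (by omega)⟩

/-- line through two points -/
def ln (a b : Fin 3 → ℂ) : MP := ∑ i, X i * C (crossProduct a b i)

lemma ln_hom (a b) : (ln a b).IsHomogeneous 1 := by
  apply IsHomogeneous.sum
  intro i _
  rw [mul_comm]
  exact isHomogeneous_C_mul_X _ _

lemma lin_eval (c v : Fin 3 → ℂ) : eval v (∑ i, X i * C (c i) : MP) = ∑ i, v i * c i := by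
  simp

lemma lin_pderiv (c : Fin 3 → ℂ) (k) : pderiv k (∑ i, X i * C (c i) : MP) = C (c k) := by
  simp only [Fin.sum_univ_three]
  fin_cases k <;> simp [pderiv_X]

lemma lin_ne {c : Fin 3 → ℂ} (h : c ≠ 0) : (∑ i, X i * C (c i) : MP) ≠ 0 := by
  intro e
  apply h
  ext k
  have := lin_pderiv c k
  rw [e] at this
  simpa using this.symm

lemma ln_left (a b) : eval a (ln a b) = 0 := by
  simp [ln, Fin.sum_univ_three, crossProduct]; ring
lemma ln_right (a b) : eval b (ln a b) = 0 := by
  simp [ln, Fin.sum_univ_three, crossProduct]; ring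

lemma cross_ne {p q : P2} (h : p ≠ q) : crossProduct p.rep q.rep ≠ 0 := by
  rw [crossProduct_ne_zero_iff_linearIndependent]
  exact Projectivization.linearIndependent_pair_iff_ne.2 h

lemma ln_ne {p q : P2} (h : p ≠ q) : ln p.rep q.rep ≠ 0 := lin_ne (cross_ne h)

lemma span_of_ln {a b w : Fin 3 → ℂ} (h : crossProduct a b ≠ 0) (hw : eval w (ln a b) = 0) :
    ∃ s t : ℂ, w = s • a + t • b := by
  simp [ln, Fin.sum_univ_three, crossProduct] at hw
  have : ∃ k, crossProduct a b k ≠ 0 := by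
    by_contra! hh
    exact h (funext hh)
  obtain ⟨k, hk⟩ := this
  fin_cases k <;> simp [crossProduct] at hk
  · obtain ⟨e, he⟩ : ∃ e, e = a 1 * b 2 - a 2 * b 1 := ⟨_, rfl⟩
    rw [← he] at hk
    refine ⟨(w 1 * b 2 - w 2 * b 1) / e, (a 1 * w 2 - a 2 * w 1) / e, ?_⟩
    ext i
    fin_cases i <;> simp <;> field_simp <;> rw [he] <;>
      first | ring1 | linear_combination hw
  · obtain ⟨e, he⟩ : ∃ e, e = a 2 * b 0 - a 0 * b 2 := ⟨_, rfl⟩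
    rw [← he] at hk
    refine ⟨(w 2 * b 0 - w 0 * b 2) / e, (a 2 * w 0 - a 0 * w 2) / e, ?_⟩
    ext i
    fin_cases i <;> simp <;> field_simp <;> rw [he] <;>
      first | ring1 | linear_combination hw
  · obtain ⟨e, he⟩ : ∃ e, e = a 0 * b 1 - a 1 * b 0 := ⟨_, rfl⟩
    rw [← he] at hk
    refine ⟨(w 0 * b 1 - w 1 * b 0) / e, (a 0 * w 1 - a 1 * w 0) / e, ?_⟩
    ext i
    fin_cases i <;> simp <;> field_simp <;> rw [he] <;>
      first | ring1 | linear_combination hw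

lemma lin_dvd {c : Fin 3 → ℂ} (h : c ≠ 0) {F : MP}
    (hF : ∀ w, eval w (∑ i, X i * C (c i) : MP) = 0 → eval w F = 0) :
    (∑ i, X i * C (c i) : MP) ∣ F := by
  have : ∃ k, c k ≠ 0 := by
    by_contra! hh
    exact h (funext hh)
  obtain ⟨k, hk⟩ := this
  set L : MP := ∑ i, X i * C (c i) with hL
  let σ : Fin 3 → MP := fun i => X i - C (Pi.single (M := fun _ => ℂ) k (c k)⁻¹ i) * L
  have h1 : aeval σ F = 0 := by
    apply MvPolynomial.funext
    intro v
    rw [map_zero]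
    have e : eval v (aeval σ F) = eval (fun i => eval v (σ i)) F := by
      have : ((aeval v : MP →ₐ[ℂ] ℂ).comp (aeval σ)) = aeval (fun i => eval v (σ i)) := by
        ext i; simp [aeval_eq_eval]
      have := DFunLike.congr_fun this F
      simpa [aeval_eq_eval] using this
    rw [e]
    apply hF
    rw [hL, lin_eval]
    simp only [σ, map_sub, map_mul, eval_X, eval_C, sub_mul, Finset.sum_sub_distrib]
    have : ∀ x, Pi.single (M := fun _ => ℂ) k (c k)⁻¹ x * eval v L * c x
        = eval v L * Pi.single (M := fun _ => ℂ) k 1 x := by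
      intro x
      by_cases hx : x = k
      · subst hx; simp; field_simp
      · simp [hx]
    rw [Finset.sum_congr rfl fun x _ => this x, ← Finset.mul_sum]
    simp [hL]
  have h2 : (Ideal.Quotient.mkₐ ℂ (Ideal.span {L})).comp (aeval σ) =
      Ideal.Quotient.mkₐ ℂ (Ideal.span {L}) := by
    ext i
    simp only [AlgHom.comp_apply, aeval_X, Ideal.Quotient.mkₐ_eq_mk]
    rw [Ideal.Quotient.eq, Ideal.mem_span_singleton]
    exact ⟨- C (Pi.single (M := fun _ => ℂ) k (c k)⁻¹ i), by simp only [σ]; ring⟩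
  have h3 := DFunLike.congr_fun h2 F
  simp only [AlgHom.comp_apply, h1, map_zero, Ideal.Quotient.mkₐ_eq_mk] at h3
  rw [eq_comm, Ideal.Quotient.eq_zero_iff_mem, Ideal.mem_span_singleton] at h3
  exact h3

lemma ln_dvd {a b : Fin 3 → ℂ} (h : crossProduct a b ≠ 0) {F : MP}
    (hF : ∀ s t : ℂ, eval (s • a + t • b) F = 0) : ln a b ∣ F := by
  apply lin_dvd h
  intro w hw
  obtain ⟨s, t, rfl⟩ := span_of_ln h hw
  exact hF s t

lemma exists_hom (d N : ℕ) (φ : Fin N → (MP →ₗ[ℂ] ℂ))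
    (hN : N < (Finset.Nat.antidiagonalTuple 3 d).card) :
    ∃ F : MP, F ≠ 0 ∧ F.IsHomogeneous d ∧ ∀ i, φ i F = 0 := by
  set S := Finset.Nat.antidiagonalTuple 3 d
  let m : (Fin 3 → ℕ) → (Fin 3 →₀ ℕ) := fun f => Finsupp.equivFunOnFinite.symm f
  let T : (S → ℂ) →ₗ[ℂ] MP := ∑ s : S, (monomial (m s)).comp (LinearMap.proj s)
  have hT : ∀ c, T c = ∑ s : S, monomial (m s) (c s) := by intro c; simp [T]
  let f : (S → ℂ) →ₗ[ℂ] (Fin N → ℂ) := LinearMap.pi fun i => (φ i).comp T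
  have : LinearMap.ker f ≠ ⊥ := LinearMap.ker_ne_bot_of_finrank_lt (by simpa using hN)
  obtain ⟨c, hc, hc0⟩ := (Submodule.ne_bot_iff _).1 this
  refine ⟨T c, ?_, ?_, ?_⟩
  · intro h
    apply hc0
    ext s
    have := congrArg (coeff (m s)) h
    rw [hT, coeff_sum, Finset.sum_eq_single s] at this
    · simpa using this
    · intro b _ hb
      rw [coeff_monomial, if_neg]
      intro e
      exact hb (Subtype.ext (Finsupp.equivFunOnFinite.symm.injective e))
    · simp
  · rw [hT]
    apply IsHomogeneous.sum
    rintro ⟨s, hs⟩ _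
    apply isHomogeneous_monomial
    rw [Finsupp.degree_eq_sum]
    simpa [m] using Finset.Nat.mem_antidiagonalTuple.1 hs
  · intro i
    exact congrFun hc i

lemma card3 : (Finset.Nat.antidiagonalTuple 3 3).card = 10 := by decide
lemma card2 : (Finset.Nat.antidiagonalTuple 3 2).card = 6 := by decide
lemma card1 : (Finset.Nat.antidiagonalTuple 3 1).card = 3 := by decide

section GPsec
open scoped Classical

/-- general position for finite sets of at most 7 points -/
def GP (T : Finset P2) : Prop :=
  (∀ S ⊆ T, S.card = 3 → ∀ L : MP, L ≠ 0 → L.IsHomogeneous 1 → ¬ ∀ p ∈ S, pVanish L p) ∧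
  (∀ S ⊆ T, S.card = 6 → ∀ L : MP, L ≠ 0 → L.IsHomogeneous 2 → ¬ ∀ p ∈ S, pVanish L p)

lemma evalHom {F : MP} {d : ℕ} (h : F.IsHomogeneous d) (c : ℂ) (v : Fin 3 → ℂ) :
    eval (c • v) F = c ^ d * eval v F := by
  rw [F.as_sum, map_sum, map_sum, Finset.mul_sum]
  apply Finset.sum_congr rfl
  intro m hm
  have e := h.degree_eq_sum_deg_support hm
  rw [eval_monomial, eval_monomial, Finsupp.prod, Finsupp.prod, e, ← Finset.prod_pow_eq_pow_sum]
  simp only [Pi.smul_apply, smul_eq_mul, mul_pow, Finset.prod_mul_distrib]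
  ring

/-- thin sets -/
def Bad (Z : Set P2) : Prop := ∃ (F : MP) (d : ℕ), F ≠ 0 ∧ F.IsHomogeneous d ∧ ∀ q ∈ Z, pVanish F q

lemma Bad.union {Z W : Set P2} (h : Bad Z) (h' : Bad W) : Bad (Z ∪ W) := by
  obtain ⟨F, d, h1, h2, h3⟩ := h
  obtain ⟨G, e, g1, g2, g3⟩ := h'
  refine ⟨F * G, d + e, mul_ne_zero h1 g1, h2.mul g2, ?_⟩
  rintro q (hq | hq)
  · have := h3 q hq
    simp only [pVanish] at *; simp [this]
  · have := g3 q hq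
    simp only [pVanish] at *; simp [this]

lemma Bad.biUnion {ι : Type} (s : Finset ι) (Z : ι → Set P2) (h : ∀ i ∈ s, Bad (Z i)) :
    Bad {q | ∃ i ∈ s, q ∈ Z i} := by
  induction s using Finset.induction_on with
  | empty => exact ⟨1, 0, one_ne_zero, isHomogeneous_one _ _, by simp⟩
  | insert a s ha ih =>
    have := (h a (by simp)).union (ih fun i hi => h i (by simp [hi]))
    convert this using 1
    ext q; simp

lemma Bad.exists_notMem {Z : Set P2} (h : Bad Z) : ∃ q, q ∉ Z := by
  obtain ⟨F, d, h1, h2, h3⟩ := h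
  have : ∃ v, eval v (F * X 0) ≠ 0 := by
    by_contra! hh
    exact mul_ne_zero h1 (X_ne_zero (0 : Fin 3)) (MvPolynomial.funext (by simpa using hh))
  obtain ⟨v, hv⟩ := this
  simp only [map_mul, eval_X] at hv
  have hv0 : v ≠ 0 := by
    rintro rfl; simp at hv
  refine ⟨Projectivization.mk ℂ v hv0, fun hq => ?_⟩
  have := h3 _ hq
  obtain ⟨a, ha⟩ := Projectivization.exists_smul_eq_mk_rep ℂ v hv0
  rw [pVanish, ← ha, Units.smul_def, evalHom h2] at this
  rcases mul_eq_zero.1 this with h | h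
  · exact pow_ne_zero d a.ne_zero h
  · exact hv (by simp [h])

/-- evaluation as a linear functional -/
def evL (v : Fin 3 → ℂ) : MP →ₗ[ℂ] ℂ := (aeval v : MP →ₐ[ℂ] ℂ).toLinearMap

lemma evL_apply (v : Fin 3 → ℂ) (F : MP) : evL v F = eval v F := by
  simp [evL, aeval_eq_eval]

lemma exists_through (d : ℕ) (S : Finset P2) (h : S.card < (Finset.Nat.antidiagonalTuple 3 d).card) :
    ∃ F : MP, F ≠ 0 ∧ F.IsHomogeneous d ∧ ∀ p ∈ S, pVanish F p := by
  obtain ⟨F, h1, h2, h3⟩ := exists_hom d S.card (fun i => evL (S.equivFin.symm i).1.rep) h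
  refine ⟨F, h1, h2, fun p hp => ?_⟩
  have := h3 (S.equivFin ⟨p, hp⟩)
  simpa [evL_apply, pVanish] using this

lemma bad_singleton (a : P2) : Bad {a} := by
  obtain ⟨F, h1, h2, h3⟩ := exists_through 1 {a} (by rw [card1]; simp)
  exact ⟨F, 1, h1, h2, by simpa using h3⟩

lemma bad_pair (S : Finset P2) (hS : S.card = 2) :
    Bad {q | ∃ L : MP, L ≠ 0 ∧ L.IsHomogeneous 1 ∧ (∀ p ∈ S, pVanish L p) ∧ pVanish L q} := by
  obtain ⟨a, b, hab, rfl⟩ := Finset.card_eq_two.1 hS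
  refine ⟨ln a.rep b.rep, 1, ln_ne hab, ln_hom _ _, ?_⟩
  rintro q ⟨L, h1, h2, h3, h4⟩
  obtain ⟨c, rfl⟩ := hom1 h2
  have hc : c ≠ 0 := by
    rintro rfl; simp at h1
  have ha := h3 a (by simp)
  have hb := h3 b (by simp)
  rw [pVanish, lin_eval] at ha hb h4
  have : (Matrix.of ![a.rep, b.rep, q.rep]).det = 0 := by
    apply Matrix.exists_mulVec_eq_zero_iff.1
    refine ⟨c, hc, ?_⟩
    ext i
    fin_cases i <;> simpa [Matrix.mulVec, dotProduct]
  rw [Matrix.det_fin_three] at this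
  simp at this
  simp [pVanish, ln, Fin.sum_univ_three, crossProduct]
  linear_combination this

lemma vanish_mul {A B : MP} {p : P2} (h : pVanish (A * B) p) (hA : ¬ pVanish A p) : pVanish B p := by
  rw [pVanish, map_mul] at h
  exact (mul_eq_zero.1 h).resolve_left hA

lemma factor_ln {Q : MP} {a b : P2} {n : ℕ} (hab : a ≠ b) (hQ : Q.IsHomogeneous (n + 1)) (h0 : Q ≠ 0)
    (hv : ∀ s t : ℂ, eval (s • a.rep + t • b.rep) Q = 0) :
    ∃ M : MP, M ≠ 0 ∧ M.IsHomogeneous n ∧ Q = ln a.rep b.rep * M := by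
  obtain ⟨M, rfl⟩ := ln_dvd (cross_ne hab) hv
  obtain ⟨i, j, hij, hi, hj⟩ := hom_factor hQ h0
  have := hi.inj_right (ln_hom _ _) (ln_ne hab)
  have hj' : j = n := by omega
  exact ⟨M, right_ne_zero_of_mul h0, hj' ▸ hj, rfl⟩

lemma ln_not {T : Finset P2} (hT : GP T) {a b p : P2} (ha : a ∈ T) (hb : b ∈ T) (hp : p ∈ T)
    (hab : a ≠ b) (hpa : p ≠ a) (hpb : p ≠ b) : ¬ pVanish (ln a.rep b.rep) p := by
  intro h
  refine hT.1 {a, b, p} ?_ ?_ _ (ln_ne hab) (ln_hom _ _) ?_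
  · intro x; simp; rintro (rfl | rfl | rfl) <;> assumption
  · rw [Finset.card_eq_three]; exact ⟨a, b, p, hab, hpa.symm, hpb.symm, rfl⟩
  · simp [h]
    exact ⟨ln_left _ _, ln_right _ _⟩

/-- key: a conic containing a line through two points contains at most two other points -/
lemma conic_key {T : Finset P2} (hT : GP T) {S : Finset P2} (hS : S ⊆ T) {a b : P2} (ha : a ∈ T)
    (hb : b ∈ T) (hab : a ≠ b) (haS : a ∉ S) (hbS : b ∉ S) (hc : 3 ≤ S.card) {Q : MP}
    (hQ : Q.IsHomogeneous 2) (h0 : Q ≠ 0)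
    (hv : ∀ s t : ℂ, eval (s • a.rep + t • b.rep) Q = 0) (hvS : ∀ p ∈ S, pVanish Q p) : False := by
  obtain ⟨M, hM0, hM, rfl⟩ := factor_ln (n := 1) hab hQ h0 hv
  obtain ⟨S', hS', hcard⟩ := Finset.exists_subset_card_eq hc
  refine hT.1 S' (hS'.trans hS) hcard M hM0 hM fun p hp => ?_
  have hpS := hS' hp
  exact vanish_mul (hvS p hpS) (ln_not hT ha hb (hS hpS) hab (fun h => haS (h ▸ hpS)) (fun h => hbS (h ▸ hpS)))

lemma bad_five {T : Finset P2} (hT : GP T) (S : Finset P2) (hST : S ⊆ T) (hS : S.card = 5) :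
    Bad {q | ∃ L : MP, L ≠ 0 ∧ L.IsHomogeneous 2 ∧ (∀ p ∈ S, pVanish L p) ∧ pVanish L q} := by
  obtain ⟨Q, h1, h2, h3⟩ := exists_through 2 S (by rw [card2, hS]; simp)
  refine ⟨Q, 2, h1, h2, ?_⟩
  rintro q ⟨Q', g1, g2, g3, g4⟩
  obtain ⟨a, ha, b, hb, hab⟩ := Finset.one_lt_card.1 (by omega : 1 < S.card)
  have key : ∀ G : MP, G.IsHomogeneous 2 → (∀ p ∈ S, pVanish G p) → eval (a.rep + b.rep) G = 0 → G = 0 := by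
    intro G hG hGS hz
    by_contra hG0
    refine conic_key hT (S := (S.erase a).erase b) (((Finset.erase_subset _ _).trans (Finset.erase_subset _ _)).trans hST)
      (hST ha) (hST hb) hab (by simp) (by simp) ?_ hG hG0 ?_ ?_
    · rw [Finset.card_erase_of_mem (by simp [hb, hab.symm]), Finset.card_erase_of_mem ha, hS]
    · intro s t
      have e := quad_line hG a.rep b.rep 1 1
      have ea : eval a.rep G = 0 := hGS a ha
      have eb : eval b.rep G = 0 := hGS b hb
      simp only [one_smul, hz, ea, eb] at e
      rw [quad_line hG, ea, eb]
      linear_combination (-s * t) * e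
    · intro p hp
      exact hGS p (by simp at hp; exact hp.2.2)
  set z := a.rep + b.rep
  have hG := key (C (eval z Q') * Q - C (eval z Q) * Q') ((h2.C_mul _).sub (g2.C_mul _)) (by
    intro p hp
    have := h3 p hp
    have := g3 p hp
    simp only [pVanish] at *
    simp [*]) (by simp; ring)
  have hz : eval z Q' ≠ 0 := fun h => g1 (key Q' g2 g3 h)
  have := congrArg (eval q.rep) hG
  simp only [pVanish] at *
  simpa [g4, hz] using this

lemma extend {T : Finset P2} (hT : GP T) : ∃ q, q ∉ T ∧ GP (insert q T) := by
  have b1 := Bad.biUnion T (fun a => {a}) fun a _ => bad_singleton a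
  have b2 := Bad.biUnion (T.powersetCard 2) _ fun S hS => bad_pair S (Finset.mem_powersetCard.1 hS).2
  have b3 := Bad.biUnion (T.powersetCard 5) _ fun S hS =>
    bad_five hT S (Finset.mem_powersetCard.1 hS).1 (Finset.mem_powersetCard.1 hS).2
  obtain ⟨q, hq⟩ := ((b1.union b2).union b3).exists_notMem
  simp only [Set.mem_union, not_or] at hq
  obtain ⟨⟨hq1, hq2⟩, hq3⟩ := hq
  refine ⟨q, fun h => hq1 ⟨q, h, rfl⟩, ?_, ?_⟩
  · intro S hS hc L hL0 hL hv
    by_cases hqS : q ∈ S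
    · refine hq2 ⟨S.erase q, Finset.mem_powersetCard.2 ⟨Finset.subset_insert_iff.1 hS, ?_⟩, L, hL0, hL, ?_, hv q hqS⟩
      · rw [Finset.card_erase_of_mem hqS, hc]
      · exact fun p hp => hv p (Finset.mem_of_mem_erase hp)
    · exact hT.1 S ((Finset.subset_insert_iff_of_notMem hqS).1 hS) hc L hL0 hL hv
  · intro S hS hc L hL0 hL hv
    by_cases hqS : q ∈ S
    · refine hq3 ⟨S.erase q, Finset.mem_powersetCard.2 ⟨Finset.subset_insert_iff.1 hS, ?_⟩, L, hL0, hL, ?_, hv q hqS⟩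
      · rw [Finset.card_erase_of_mem hqS, hc]
      · exact fun p hp => hv p (Finset.mem_of_mem_erase hp)
    · exact hT.2 S ((Finset.subset_insert_iff_of_notMem hqS).1 hS) hc L hL0 hL hv

lemma extend7 (k : ℕ) {T : Finset P2} (hT : GP T) (h : T.card + k = 7) :
    ∃ T', T ⊆ T' ∧ T'.card = 7 ∧ GP T' := by
  induction k generalizing T with
  | zero => exact ⟨T, subset_rfl, h, hT⟩
  | succ k ih =>
    obtain ⟨q, hq, hg⟩ := extend hT
    obtain ⟨T', h1, h2⟩ := ih hg (by rw [Finset.card_insert_of_notMem hq]; omega)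
    exact ⟨T', (Finset.subset_insert _ _).trans h1, h2⟩

lemma no_LQ {T : Finset P2} (hT : GP T) (hc : T.card = 7) {o : P2} (ho : o ∈ T) {L Q : MP}
    (hL : L.IsHomogeneous 1) (hQ : Q.IsHomogeneous 2) (h0 : L * Q ≠ 0)
    (hv : ∀ p ∈ T, pVanish (L * Q) p) (hd : ∀ i, eval o.rep (pderiv i (L * Q)) = 0) : False := by
  have hL0 := left_ne_zero_of_mul h0
  have hQ0 := right_ne_zero_of_mul h0
  set A := (T.erase o).filter fun p => pVanish L p with hA
  set B := (T.erase o).filter fun p => ¬ pVanish L p with hB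
  have hAB : A.card + B.card = 6 := by
    rw [Finset.card_filter_add_card_filter_not, Finset.card_erase_of_mem ho, hc]
  have hAT : A ⊆ T := (Finset.filter_subset _ _).trans (Finset.erase_subset _ _)
  have hBT : B ⊆ T := (Finset.filter_subset _ _).trans (Finset.erase_subset _ _)
  have hoA : o ∉ A := by simp [hA]
  have hoB : o ∉ B := by simp [hB]
  have hBQ : ∀ p ∈ B, pVanish Q p := fun p hp =>
    vanish_mul (hv p (hBT hp)) (Finset.mem_filter.1 hp).2
  have hd' : ∀ i, eval o.rep L * eval o.rep (pderiv i Q) + eval o.rep Q * eval o.rep (pderiv i L) = 0 := by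
    intro i
    have := hd i
    simp [Derivation.leibniz] at this
    linear_combination this
  by_cases hLo : pVanish L o
  · have hLo' : eval o.rep L = 0 := hLo
    have hA1 : A.card ≤ 1 := by
      by_contra! hh
      obtain ⟨A', hA', hcA⟩ := Finset.exists_subset_card_eq (show 2 ≤ A.card by omega)
      refine hT.1 (insert o A') (Finset.insert_subset ho (hA'.trans hAT)) ?_ L hL0 hL ?_
      · rw [Finset.card_insert_of_notMem (fun h => hoA (hA' h)), hcA]
      · intro p hp
        rcases Finset.mem_insert.1 hp with rfl | hp
        · exact hLo
        · exact (Finset.mem_filter.1 (hA' hp)).2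
    have hQo : pVanish Q o := by
      by_contra hh
      obtain ⟨c, rfl⟩ := hom1 hL
      have : c = 0 := by
        ext i
        have := hd' i
        rw [lin_pderiv, hLo', eval_C, zero_mul, zero_add] at this
        exact (mul_eq_zero.1 this).resolve_left hh
      subst this
      simp at hL0
    obtain ⟨B', hB', hcB⟩ := Finset.exists_subset_card_eq (show 5 ≤ B.card by omega)
    refine hT.2 (insert o B') (Finset.insert_subset ho (hB'.trans hBT)) ?_ Q hQ0 hQ ?_
    · rw [Finset.card_insert_of_notMem (fun h => hoB (hB' h)), hcB]
    · intro p hp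
      rcases Finset.mem_insert.1 hp with rfl | hp
      · exact hQo
      · exact hBQ p (hB' hp)
  · have hQo : eval o.rep Q = 0 := vanish_mul (hv o ho) hLo
    have hdQ : ∀ i, eval o.rep (pderiv i Q) = 0 := by
      intro i
      have := hd' i
      rw [hQo, zero_mul, add_zero] at this
      exact (mul_eq_zero.1 this).resolve_left hLo
    have hA2 : A.card ≤ 2 := by
      by_contra! hh
      obtain ⟨A', hA', hcA⟩ := Finset.exists_subset_card_eq (show 3 ≤ A.card by omega)
      exact hT.1 A' (hA'.trans hAT) hcA L hL0 hL fun p hp => (Finset.mem_filter.1 (hA' hp)).2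
    obtain ⟨b, hb⟩ := Finset.card_pos.1 (show 0 < B.card by omega)
    have hob : o ≠ b := fun h => hoB (h ▸ hb)
    refine conic_key hT (S := B.erase b) ((Finset.erase_subset _ _).trans hBT) ho (hBT hb) hob
      (fun h => hoB (Finset.mem_of_mem_erase h)) (by simp) ?_ hQ hQ0 ?_ ?_
    · rw [Finset.card_erase_of_mem hb]; omega
    · intro s t
      have eb : eval b.rep Q = 0 := hBQ b hb
      rw [quad_line hQ, hQo, eb]
      simp [hdQ]
    · exact fun p hp => hBQ p (Finset.mem_of_mem_erase hp)

lemma mult1 {F : MP} {v : Fin 3 → ℂ} (h : eval v F = 0) : HasMultGE F v 1 := by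
  intro k hk
  have h0 : k 0 = 0 := by omega
  have h1 : k 1 = 0 := by omega
  have h2 : k 2 = 0 := by omega
  simp [iterDeriv, h0, h1, h2, h]

lemma mult2 {F : MP} {v : Fin 3 → ℂ} (h : eval v F = 0) (hd : ∀ i, eval v (pderiv i F) = 0) :
    HasMultGE F v 2 := by
  intro k hk
  by_cases h0 : k 0 = 0
  · by_cases h1 : k 1 = 0
    · by_cases h2 : k 2 = 0
      · simp [iterDeriv, h0, h1, h2, h]
      · have h2 : k 2 = 1 := by omega
        simp [iterDeriv, h0, h1, h2, hd]
    · have h1 : k 1 = 1 := by omega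
      have h2 : k 2 = 0 := by omega
      simp [iterDeriv, h0, h1, h2, hd]
  · have h0 : k 0 = 1 := by omega
    have h1 : k 1 = 0 := by omega
    have h2 : k 2 = 0 := by omega
    simp [iterDeriv, h0, h1, h2, hd]

lemma of_mult2 {F : MP} {v : Fin 3 → ℂ} (h : HasMultGE F v 2) (i : Fin 3) :
    eval v (pderiv i F) = 0 := by
  fin_cases i
  · simpa [iterDeriv] using h ![1, 0, 0] (by simp)
  · simpa [iterDeriv] using h ![0, 1, 0] (by simp)
  · simpa [iterDeriv] using h ![0, 0, 1] (by simp)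

lemma pMult_eq {F : MP} {p : P2} {m : ℕ} (h : pHasMultGE F p m) (h' : ¬ pHasMultGE F p (m+1)) :
    pMult F p = m := by
  have : {k : ℕ | pHasMultGE F p k} = Set.Iic m := by
    ext k
    simp only [Set.mem_ofPred_eq, Set.mem_Iic]
    constructor
    · intro hk
      by_contra! hlt
      exact h' fun j hj => hk j (by omega)
    · intro hk j hj
      exact h j (by omega)
  rw [pMult, this]
  exact csSup_Iic

lemma core {T : Finset P2} (hT : GP T) (hc : T.card = 7) {o : P2} (ho : o ∈ T) :
    ∃ F : MP, F.IsHomogeneous 3 ∧ Irreducible F ∧ pMult F o = 2 ∧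
      ∀ p ∈ T, p ≠ o → pMult F p = 1 := by
  have hc6 : (T.erase o).card = 6 := by rw [Finset.card_erase_of_mem ho, hc]
  let e := (T.erase o).equivFinOfCardEq hc6
  obtain ⟨F, hF0, hF, hφ⟩ := exists_hom 3 9 (Fin.append (m := 6) (n := 3)
    (fun i => evL (e.symm i).1.rep) (fun i => (evL o.rep).comp (pderiv i).toLinearMap))
    (by rw [card3]; simp)
  have hd : ∀ i, eval o.rep (pderiv i F) = 0 := by
    intro i
    have := hφ (Fin.natAdd 6 i)
    rw [Fin.append_right] at this
    simpa [evL_apply] using this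
  have ho0 : eval o.rep F = 0 := by
    have := congrArg (eval o.rep) hF.sum_X_mul_pderiv
    simpa [hd] using this
  have hv : ∀ p ∈ T, pVanish F p := by
    intro p hp
    by_cases hpo : p = o
    · subst hpo; exact ho0
    · have := hφ (Fin.castAdd 3 (e ⟨p, by simp [hp, hpo]⟩))
      rw [Fin.append_left] at this
      simpa [evL_apply, pVanish] using this
  have hirr : Irreducible F := by
    constructor
    · intro hu
      obtain ⟨c, hc1, hc2⟩ := (MvPolynomial.isUnit_iff_eq_C_of_isReduced).1 hu
      have := hF.inj_right (hc2 ▸ isHomogeneous_C _ c) hF0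
      omega
    · rintro A B rfl
      obtain ⟨i, j, hij, hA, hB⟩ := hom_factor hF hF0
      have unit : ∀ P : MP, P ≠ 0 → P.IsHomogeneous 0 → IsUnit P := by
        intro P hP h
        obtain ⟨c, rfl⟩ := hom0 h
        exact (IsUnit.mk0 c (by rintro rfl; simp at hP)).map C
      have hi : i ≤ 3 := by omega
      interval_cases i
      · exact Or.inl (unit A (left_ne_zero_of_mul hF0) hA)
      · obtain rfl : j = 2 := by omega
        exact (no_LQ hT hc ho hA hB hF0 hv hd).elim
      · obtain rfl : j = 1 := by omega
        rw [mul_comm] at hF0 hd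
        simp_rw [mul_comm A B] at hv
        exact (no_LQ hT hc ho hB hA hF0 hv hd).elim
      · obtain rfl : j = 0 := by omega
        exact Or.inr (unit B (right_ne_zero_of_mul hF0) hB)
  have noline : ∀ p ∈ T, p ≠ o → ¬ ∀ s t : ℂ, eval (s • o.rep + t • p.rep) F = 0 := by
    intro p hp hpo hl
    obtain ⟨M, hM0, hM, rfl⟩ := factor_ln (n := 2) hpo.symm hF hF0 hl
    exact no_LQ hT hc ho (ln_hom _ _) hM hF0 hv hd
  refine ⟨F, hF, hirr, pMult_eq (mult2 ho0 hd) ?_, fun p hp hpo => pMult_eq (mult1 (hv p hp)) ?_⟩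
  · intro h3
    obtain ⟨p, hp⟩ := Finset.card_pos.1 (show 0 < (T.erase o).card by omega)
    have hpo := Finset.ne_of_mem_erase hp
    have hpT := Finset.mem_of_mem_erase hp
    apply noline p hpT hpo
    intro s t
    have ep : eval p.rep F = 0 := hv p hpT
    have d00 : eval o.rep (pderiv 0 (pderiv 0 F)) = 0 := by
      simpa [iterDeriv] using h3 ![2, 0, 0] (by simp)
    have d11 : eval o.rep (pderiv 1 (pderiv 1 F)) = 0 := by
      simpa [iterDeriv] using h3 ![0, 2, 0] (by simp)
    have d22 : eval o.rep (pderiv 2 (pderiv 2 F)) = 0 := by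
      simpa [iterDeriv] using h3 ![0, 0, 2] (by simp)
    have d01 : eval o.rep (pderiv 0 (pderiv 1 F)) = 0 := by
      simpa [iterDeriv] using h3 ![1, 1, 0] (by simp)
    have d02 : eval o.rep (pderiv 0 (pderiv 2 F)) = 0 := by
      simpa [iterDeriv] using h3 ![1, 0, 1] (by simp)
    have d12 : eval o.rep (pderiv 1 (pderiv 2 F)) = 0 := by
      simpa [iterDeriv] using h3 ![0, 1, 1] (by simp)
    rw [cubic_line2 hF, ho0, ep, d00, d11, d22, d01, d02, d12]
    simp [hd]
  · intro h2
    apply noline p hp hpo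
    intro s t
    have ep : eval p.rep F = 0 := hv p hp
    rw [cubic_line hF, ho0, ep]
    simp [hd, of_mult2 h2]

lemma gp_of_genPos {n : ℕ} {p : Fin n → P2} (h : GenPos p) : GP (Finset.univ.image p) := by
  have emb : ∀ (m : ℕ) (S : Finset P2), S ⊆ Finset.univ.image p → S.card = m →
      ∃ f : Fin m ↪ Fin n, ∀ k, p (f k) ∈ S := by
    intro m S hS hc
    let e := S.equivFinOfCardEq hc
    have : ∀ k, ∃ i, p i = (e.symm k).1 := by
      intro k
      simpa using hS (e.symm k).2
    choose f hf using this
    refine ⟨⟨f, fun k l hkl => ?_⟩, fun k => ?_⟩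
    · have : (e.symm k).1 = (e.symm l).1 := by rw [← hf, ← hf, hkl]
      exact e.symm.injective (Subtype.ext this)
    · exact (hf k).symm ▸ (e.symm k).2
  constructor
  · intro S hS hc L h0 h1 hv
    obtain ⟨f, hf⟩ := emb 3 S hS hc
    exact h.2.1 f ⟨L, h0, h1, fun k => hv _ (hf k)⟩
  · intro S hS hc L h0 h1 hv
    obtain ⟨f, hf⟩ := emb 6 S hS hc
    exact h.2.2.1 f ⟨L, h0, h1, fun k => hv _ (hf k)⟩

end GPsec

end AC

/-- Let `r ≤ 6`, let `X_r` be the blow-up of `ℙ²` at `r` distinct points in general position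
and let `x` be a point of `X_r` in general position.  Then there is an irreducible and
reduced member `D_x` of `|-K_{X_r}|` (an irreducible curve of class `3H - E₁ - ⋯ - E_r`)
with `mult_x D_x = 2`. -/
theorem exists_anticanonical_member_mult_two
    (r : ℕ) (hr : r ≤ 6) (pts : Fin r → P2) (hpts : GenPos pts)
    (B : BlowupP2 r pts) (x : B.X) (hx : B.genPosPt x) :
    ∃ C : B.Curve, B.degH C = 3 ∧ (∀ i, B.multE C i = 1) ∧ B.mult x C = 2 := by
  classical
  obtain ⟨hx1, hx2⟩ := hx
  set T := Finset.univ.image (Fin.snoc pts (B.μ x) : Fin (r+1) → P2) with hTdef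
  have hT : AC.GP T := AC.gp_of_genPos hx2
  have hcard : T.card = r + 1 := by
    rw [hTdef, Finset.card_image_of_injective _ hx2.1]; simp
  obtain ⟨T', hsub, hc7, hT'⟩ := AC.extend7 (6 - r) hT (by omega)
  have hmx : B.μ x ∈ T' := hsub (Finset.mem_image.2 ⟨Fin.last r, by simp, by simp⟩)
  have hmp : ∀ i, pts i ∈ T' := fun i =>
    hsub (Finset.mem_image.2 ⟨i.castSucc, by simp, by simp⟩)
  obtain ⟨F, hF, hirr, h2, h1⟩ := AC.core hT' hc7 hmx
  obtain ⟨C, hC1, hC2, hC3, -⟩ := B.strict_exists 3 F hF hirr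
  refine ⟨C, hC1, fun i => ?_, ?_⟩
  · rw [hC2, h1 _ (hmp i) (fun h => hx1 ⟨i, h⟩)]; simp
  · rw [(hC3 x hx1).2, h2]
end
end
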